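/- arXiv:1904.10244 — 2 statements merged into one kernel-verified Lean document; each statement's English description precedes it below -/
import Mathlib

section
/- For each n ≥ 1 let i_n denote the number of pairs (F, J) where F is an acyclic simple graph (forest) on the vertex set Fin n and J is a maximal independent set of F. Then there exist real constants A > 0 and ρ₁ with 0 < ρ₁ < e^{-1} such that the sequence i_n · ρ₁^n · n^{5/2} / n! converges to A as n → ∞. -/
open Filter Topology MeasureTheory

/-- `J` is an independent set of the simple graph `G`. -/
def IsIndepSet {V : Type*} (G : SimpleGraph V) (J : Set V) : Prop :=
  ∀ ⦃u v : V⦄, u ∈ J → v ∈ J → ¬ G.Adj u v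

/-- `J` is a maximal independent set of `G`. -/
def IsMaximalIndepSet {V : Type*} (G : SimpleGraph V) (J : Set V) : Prop :=
  IsIndepSet G J ∧ ∀ J' : Set V, IsIndepSet G J' → ¬ J ⊂ J'

/-- The pairs `(F, J)` where `F` is a forest (acyclic simple graph) on `Fin n`
and `J` is a maximal independent set of `F`. -/
def MISpace (n : ℕ) :=
  {p : SimpleGraph (Fin n) × Set (Fin n) // p.1.IsAcyclic ∧ IsMaximalIndepSet p.1 p.2}

/-- `iN n` is the number of pairs `(F, J)` where `F` is a forest on `Fin n`
and `J` is a maximal independent set of `F`. -/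
noncomputable def iN (n : ℕ) : ℕ := Nat.card (MISpace n)

namespace ForestMIS

section Local

variable {L : Type}

theorem reachable_comap_iff {V W : Type} (f : V ↪ W) (G : SimpleGraph W)
    (hf : ∀ x y, G.Adj (f x) y → y ∈ Set.range f) (x y : V) :
    (G.comap f).Reachable x y ↔ G.Reachable (f x) (f y) := by
  refine ⟨fun h => h.map ⟨f, fun {a b} hab => hab⟩, ?_⟩
  rintro ⟨p⟩
  generalize hu : f x = u at p
  generalize hv : f y = v at p
  induction p generalizing x with
  | nil => rw [f.injective (hu.trans hv.symm)]
  | @cons u w v h p ih =>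
    subst hu
    obtain ⟨z, rfl⟩ := hf _ _ h
    have hxz : (G.comap f).Adj x z := h
    exact hxz.reachable.trans (ih z rfl hv)

/-- A property of a vertex of a labelled graph that only depends on the connected component
of that vertex, up to isomorphism. -/
def IsLocal (Q : ∀ V : Type, SimpleGraph V → (V → L) → V → Prop) : Prop :=
  ∀ (V W : Type) (f : V ↪ W) (G : SimpleGraph W) (σ : W → L),
    (∀ x y, G.Adj (f x) y → y ∈ Set.range f) →
      ∀ v, Q V (G.comap f) (σ ∘ f) v ↔ Q W G σ (f v)

theorem IsLocal.and {Q R : ∀ V : Type, SimpleGraph V → (V → L) → V → Prop}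
    (hQ : IsLocal Q) (hR : IsLocal R) : IsLocal fun V G σ v => Q V G σ v ∧ R V G σ v :=
  fun V W f G σ hf v => and_congr (hQ V W f G σ hf v) (hR V W f G σ hf v)

theorem isLocal_label (q : L → Prop) : IsLocal fun V _ (σ : V → L) v => q (σ v) :=
  fun _ _ _ _ _ _ _ => Iff.rfl

theorem isLocal_forall_adj (q : L → L → Prop) :
    IsLocal fun V G (σ : V → L) v => ∀ u, G.Adj v u → q (σ v) (σ u) := by
  intro V W f G σ hf v
  refine ⟨fun h u hu => ?_, fun h u hu => h (f u) hu⟩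
  obtain ⟨z, rfl⟩ := hf _ _ hu
  exact h z hu

theorem isLocal_exists_adj (q : L → Prop) (r : L → Prop) :
    IsLocal fun V G (σ : V → L) v => r (σ v) ∨ ∃ u, G.Adj v u ∧ q (σ u) := by
  intro V W f G σ hf v
  refine or_congr Iff.rfl ⟨fun ⟨u, hu⟩ => ⟨f u, hu⟩, ?_⟩
  rintro ⟨u, hu, hq⟩
  obtain ⟨z, rfl⟩ := hf _ _ hu
  exact ⟨z, hu, hq⟩

theorem isLocal_existsUnique_reachable (r : L → Prop) :
    IsLocal fun V G (σ : V → L) v => ∃! x, r (σ x) ∧ G.Reachable v x := by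
  intro V W f G σ hf v
  have hran : ∀ y, G.Reachable (f v) y → y ∈ Set.range f := by
    intro y hy
    rw [SimpleGraph.reachable_iff_reflTransGen] at hy
    induction hy with
    | refl => exact ⟨v, rfl⟩
    | tail _ h ih =>
      obtain ⟨z, rfl⟩ := ih
      exact hf _ _ h
  constructor
  · rintro ⟨x, ⟨hx, hvx⟩, hu⟩
    refine ⟨f x, ⟨hx, (reachable_comap_iff f G hf v x).1 hvx⟩, ?_⟩
    rintro y ⟨hy, hvy⟩
    obtain ⟨z, rfl⟩ := hran y hvy
    rw [hu z ⟨hy, (reachable_comap_iff f G hf v z).2 hvy⟩]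
  · rintro ⟨x, ⟨hx, hvx⟩, hu⟩
    obtain ⟨z, rfl⟩ := hran x hvx
    refine ⟨z, ⟨hx, (reachable_comap_iff f G hf v z).2 hvx⟩, ?_⟩
    rintro y ⟨hy, hvy⟩
    exact f.injective (hu (f y) ⟨hy, (reachable_comap_iff f G hf v y).1 hvy⟩)

theorem isLocal_isBridge :
    IsLocal fun V G (_ : V → L) v => ∀ u, G.Adj v u → G.IsBridge s(v, u) := by
  intro V W f G σ hf v
  have key : ∀ u, (G.comap f).IsBridge s(v, u) ↔ G.IsBridge s(f v, f u) := by
    intro u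
    rw [SimpleGraph.isBridge_iff, SimpleGraph.isBridge_iff]
    have h1 : (G.comap f).deleteEdges {s(v, u)} = (G.deleteEdges {s(f v, f u)}).comap f := by
      ext a b
      simp [SimpleGraph.deleteEdges_adj, f.injective.eq_iff]
    rw [h1, reachable_comap_iff]
    intro x y hxy
    exact hf x y (SimpleGraph.deleteEdges_le _ hxy)
  refine ⟨fun h u hu => ?_, fun h u hu => (key u).2 (h (f u) hu)⟩
  obtain ⟨z, rfl⟩ := hf _ _ hu
  exact (key z).1 (h z hu)

/-- The number of labelled graphs on `V` all of whose vertices satisfy `Q`. -/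
noncomputable def count (Q : ∀ V : Type, SimpleGraph V → (V → L) → V → Prop) (V : Type) : ℕ :=
  Nat.card {p : SimpleGraph V × (V → L) // ∀ v, Q V p.1 p.2 v}

/-- The number of connected labelled graphs on `V` all of whose vertices satisfy `Q`. -/
noncomputable def connCount (Q : ∀ V : Type, SimpleGraph V → (V → L) → V → Prop)
    (V : Type) : ℕ :=
  Nat.card {p : SimpleGraph V × (V → L) // (∀ v, Q V p.1 p.2 v) ∧ p.1.Connected}

variable {Q : ∀ V : Type, SimpleGraph V → (V → L) → V → Prop}

/-- Relabelling the vertices of labelled graphs along an equivalence. -/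
def transport {V W : Type} (e : V ≃ W) : (SimpleGraph W × (W → L)) ≃ (SimpleGraph V × (V → L)) :=
  (e.symm.simpleGraph).prodCongr (e.symm.arrowCongr (Equiv.refl L))

theorem transport_apply {V W : Type} (e : V ≃ W) (p : SimpleGraph W × (W → L)) :
    transport e p = (p.1.comap e, p.2 ∘ e) := rfl

theorem IsLocal.forall_transport (hQ : IsLocal Q) {V W : Type} (e : V ≃ W)
    (p : SimpleGraph W × (W → L)) :
    (∀ v, Q V (transport e p).1 (transport e p).2 v) ↔ ∀ v, Q W p.1 p.2 v := by
  rw [transport_apply, e.surjective.forall]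
  exact forall_congr' (hQ V W e.toEmbedding p.1 p.2 (fun x y _ => e.surjective y))

theorem connected_transport {V W : Type} (e : V ≃ W) (p : SimpleGraph W × (W → L)) :
    (transport e p).1.Connected ↔ p.1.Connected :=
  SimpleGraph.Iso.connected_iff ⟨e, Iff.rfl⟩

theorem IsLocal.count_congr (hQ : IsLocal Q) {V W : Type} (e : V ≃ W) :
    count Q V = count Q W :=
  (Nat.card_congr ((transport e).subtypeEquiv fun p => (hQ.forall_transport e p).symm)).symm

theorem IsLocal.connCount_congr (hQ : IsLocal Q) {V W : Type} (e : V ≃ W) :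
    connCount Q V = connCount Q W :=
  (Nat.card_congr ((transport e).subtypeEquiv fun p =>
    (and_congr (hQ.forall_transport e p) (connected_transport e p)).symm)).symm

theorem IsLocal.card_component (hQ : IsLocal Q) {V : Type} (S : Set V) (a : V) (ha : a ∈ S) :
    Nat.card {p : SimpleGraph V × (V → L) //
      (∀ v, Q V p.1 p.2 v) ∧ ∀ x, p.1.Reachable a x ↔ x ∈ S} =
      connCount Q S * count Q (Sᶜ : Set V) := by
  classical
  set f₁ : S ↪ V := Function.Embedding.subtype _
  set f₂ : (Sᶜ : Set V) ↪ V := Function.Embedding.subtype _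
  have cl₁ : ∀ G : SimpleGraph V, (∀ x y, G.Adj x y → (x ∈ S ↔ y ∈ S)) →
      ∀ x y, G.Adj (f₁ x) y → y ∈ Set.range f₁ :=
    fun G h x y hxy => ⟨⟨y, (h _ _ hxy).1 x.2⟩, rfl⟩
  have cl₂ : ∀ G : SimpleGraph V, (∀ x y, G.Adj x y → (x ∈ S ↔ y ∈ S)) →
      ∀ x y, G.Adj (f₂ x) y → y ∈ Set.range f₂ :=
    fun G h x y hxy => ⟨⟨y, fun hy => x.2 ((h _ _ hxy).2 hy)⟩, rfl⟩
  have closed : ∀ G : SimpleGraph V, (∀ x, G.Reachable a x ↔ x ∈ S) →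
      ∀ x y, G.Adj x y → (x ∈ S ↔ y ∈ S) := fun G h x y hxy => by
    rw [← h, ← h]
    exact ⟨fun h => h.trans hxy.reachable, fun h => h.trans hxy.symm.reachable⟩
  have hall : ∀ (G : SimpleGraph V) (σ : V → L), (∀ x y, G.Adj x y → (x ∈ S ↔ y ∈ S)) →
      ((∀ v, Q V G σ v) ↔ (∀ v, Q S (G.comap f₁) (σ ∘ f₁) v) ∧
        ∀ v, Q (Sᶜ : Set V) (G.comap f₂) (σ ∘ f₂) v) := by
    intro G σ h
    have h1 := hQ _ _ f₁ G σ (cl₁ G h)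
    have h2 := hQ _ _ f₂ G σ (cl₂ G h)
    refine ⟨fun hv => ⟨fun v => (h1 v).2 (hv _), fun v => (h2 v).2 (hv _)⟩, fun hv v => ?_⟩
    by_cases hvS : v ∈ S
    · exact (h1 ⟨v, hvS⟩).1 (hv.1 _)
    · exact (h2 ⟨v, hvS⟩).1 (hv.2 _)
  rw [connCount, count, ← Nat.card_prod]
  refine Nat.card_eq_of_bijective (fun p => (⟨(p.1.1.comap f₁, p.1.2 ∘ f₁),
    ((hall _ _ (closed _ p.2.2)).1 p.2.1).1, ?_⟩, ⟨(p.1.1.comap f₂, p.1.2 ∘ f₂),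
    ((hall _ _ (closed _ p.2.2)).1 p.2.1).2⟩)) ⟨?_, ?_⟩
  · have : Nonempty S := ⟨⟨a, ha⟩⟩
    refine ⟨fun x y => ?_⟩
    rw [reachable_comap_iff f₁ _ (cl₁ _ (closed _ p.2.2))]
    exact (((p.2.2 _).2 x.2).symm).trans ((p.2.2 _).2 y.2)
  · rintro ⟨⟨G, σ⟩, hG, hS⟩ ⟨⟨G', σ'⟩, hG', hS'⟩ h
    simp only [Prod.mk.injEq, Subtype.mk.injEq] at h
    obtain ⟨⟨h1, h2⟩, h3, h4⟩ := h
    simp only [Subtype.mk.injEq, Prod.mk.injEq]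
    constructor
    · ext x y
      have hc := closed _ hS x y
      have hc' := closed _ hS' x y
      by_cases hx : x ∈ S
      · by_cases hy : y ∈ S
        · have : (G.comap f₁).Adj ⟨x, hx⟩ ⟨y, hy⟩ ↔ (G'.comap f₁).Adj ⟨x, hx⟩ ⟨y, hy⟩ := by
            rw [h1]
          exact this
        · tauto
      · by_cases hy : y ∈ S
        · tauto
        · have : (G.comap f₂).Adj ⟨x, hx⟩ ⟨y, hy⟩ ↔ (G'.comap f₂).Adj ⟨x, hx⟩ ⟨y, hy⟩ := by
            rw [h3]
          exact this
    · ext x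
      by_cases hx : x ∈ S
      · exact congrFun h2 ⟨x, hx⟩
      · exact congrFun h4 ⟨x, hx⟩
  · rintro ⟨⟨⟨G₁, σ₁⟩, hG₁, hc⟩, ⟨⟨G₂, σ₂⟩, hG₂⟩⟩
    set G : SimpleGraph V := G₁.map f₁ ⊔ G₂.map f₂
    set σ : V → L := fun x => if h : x ∈ S then σ₁ ⟨x, h⟩ else σ₂ ⟨x, h⟩
    have hc₁ : G.comap f₁ = G₁ := by
      ext x y
      simp only [G, SimpleGraph.comap_adj, SimpleGraph.sup_adj, SimpleGraph.map_adj]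
      constructor
      · rintro (⟨u, v, h, hu, hv⟩ | ⟨u, v, h, hu, hv⟩)
        · rwa [← f₁.injective hu, ← f₁.injective hv]
        · exact absurd (show f₂ u ∈ S from hu ▸ x.2) u.2
      · exact fun h => Or.inl ⟨x, y, h, rfl, rfl⟩
    have hc₂ : G.comap f₂ = G₂ := by
      ext x y
      simp only [G, SimpleGraph.comap_adj, SimpleGraph.sup_adj, SimpleGraph.map_adj]
      constructor
      · rintro (⟨u, v, h, hu, hv⟩ | ⟨u, v, h, hu, hv⟩)
        · exact absurd (show f₂ x ∈ S from hu ▸ u.2) x.2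
        · rwa [← f₂.injective hu, ← f₂.injective hv]
      · exact fun h => Or.inr ⟨x, y, h, rfl, rfl⟩
    have hs₁ : σ ∘ f₁ = σ₁ := by
      ext x
      exact dif_pos x.2
    have hs₂ : σ ∘ f₂ = σ₂ := by
      ext x
      exact dif_neg x.2
    have hcl : ∀ x y, G.Adj x y → (x ∈ S ↔ y ∈ S) := by
      intro x y hxy
      simp only [G, SimpleGraph.sup_adj, SimpleGraph.map_adj] at hxy
      rcases hxy with ⟨u, v, -, rfl, rfl⟩ | ⟨u, v, -, rfl, rfl⟩
      · exact iff_of_true u.2 v.2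
      · exact iff_of_false u.2 v.2
    have hreach : ∀ x, G.Reachable a x ↔ x ∈ S := by
      intro x
      constructor
      · intro h
        rw [SimpleGraph.reachable_iff_reflTransGen] at h
        induction h with
        | refl => exact ha
        | tail _ h ih => exact (hcl _ _ h).1 ih
      · intro hx
        have := (reachable_comap_iff f₁ G (cl₁ G hcl) ⟨a, ha⟩ ⟨x, hx⟩).1
        rw [hc₁] at this
        exact this (hc.preconnected _ _)
    refine ⟨⟨(G, σ), (hall G σ hcl).2 ⟨?_, ?_⟩, hreach⟩, ?_⟩
    · simpa only [hc₁, hs₁] using hG₁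
    · simpa only [hc₂, hs₂] using hG₂
    · simp only [hc₁, hs₁, hc₂, hs₂]

theorem IsLocal.count_succ (hQ : IsLocal Q) [Finite L] (n : ℕ) :
    count Q (Fin (n + 1)) = ∑ k ∈ Finset.range (n + 1),
      n.choose k * (connCount Q (Fin (k + 1)) * count Q (Fin (n - k))) := by
  classical
  rw [hQ.count_congr (finSuccEquiv n)]
  set V := Option (Fin n)
  have hfib : count Q V = ∑ T : Finset (Fin n),
      Nat.card {p : SimpleGraph V × (V → L) //
        (∀ v, Q V p.1 p.2 v) ∧ ∀ x, p.1.Reachable none x ↔ x ∈ (T.insertNone : Set V)} := by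
    rw [← Nat.card_sigma, count]
    refine Nat.card_congr ?_
    refine (Equiv.sigmaFiberEquiv (fun p : {p : SimpleGraph V × (V → L) // ∀ v, Q V p.1 p.2 v} =>
      Finset.univ.filter fun x : Fin n => p.1.1.Reachable none (some x))).symm.trans ?_
    refine Equiv.sigmaCongrRight fun T => ?_
    refine (Equiv.subtypeSubtypeEquivSubtypeInter _
      (fun p : SimpleGraph V × (V → L) => Finset.univ.filter
        (fun x : Fin n => p.1.Reachable none (some x)) = T)).trans ?_
    refine Equiv.subtypeEquivRight fun p => and_congr_right fun _ => ?_
    rw [Finset.ext_iff, Option.forall]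
    simp [V]
  rw [hfib]
  have hT : ∀ T : Finset (Fin n), Nat.card {p : SimpleGraph V × (V → L) //
        (∀ v, Q V p.1 p.2 v) ∧ ∀ x, p.1.Reachable none x ↔ x ∈ (T.insertNone : Set V)} =
      connCount Q (Fin (T.card + 1)) * count Q (Fin (n - T.card)) := by
    intro T
    rw [hQ.card_component _ none (by simp)]
    congr 1
    · refine hQ.connCount_congr (Finite.equivFinOfCardEq ?_)
      rw [Nat.card_coe_set_eq, Set.ncard_coe_finset, Finset.card_insertNone]
    · refine hQ.count_congr (Finite.equivFinOfCardEq ?_)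
      rw [Nat.card_coe_set_eq, Set.ncard_compl, Set.ncard_coe_finset, Finset.card_insertNone]
      simp
  rw [Finset.sum_congr rfl fun T _ => hT T, ← Finset.powerset_univ,
    Finset.sum_powerset_apply_card
      (fun k => connCount Q (Fin (k + 1)) * count Q (Fin (n - k)))]
  simp

theorem count_fin_zero : count Q (Fin 0) = 1 := by
  rw [count, Nat.card_eq_one_iff_unique]
  refine ⟨⟨fun p q => Subtype.ext (Prod.ext (SimpleGraph.ext (funext finZeroElim)) (funext finZeroElim))⟩,
    ⟨⟨⟨⊥, finZeroElim⟩, finZeroElim⟩⟩⟩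

end Local

/-- The local conditions saying that `J` is a maximal independent set of a forest. -/
def forestQ (V : Type) (G : SimpleGraph V) (J : V → Prop) (v : V) : Prop :=
  (∀ u, G.Adj v u → G.IsBridge s(v, u)) ∧ (∀ u, G.Adj v u → ¬(J v ∧ J u)) ∧
    (J v ∨ ∃ u, G.Adj v u ∧ J u)

/-- The local conditions for a rooted forest together with an independent set. A label consists
of membership in the independent set and of being a root. All vertices that are neither in the
set nor adjacent to it are roots, and there are none of these unless `β` holds.
If `α` holds then the roots are not in the set. -/
def rootedQ (α β : Prop) (V : Type) (G : SimpleGraph V) (σ : V → Prop × Prop) (v : V) : Prop :=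
  (∀ u, G.Adj v u → G.IsBridge s(v, u)) ∧ (∃! x, (σ x).2 ∧ G.Reachable v x) ∧
    (∀ u, G.Adj v u → ¬((σ v).1 ∧ (σ u).1)) ∧
    (((σ v).1 ∨ (β ∧ (σ v).2)) ∨ ∃ u, G.Adj v u ∧ (σ u).1) ∧ (α → (σ v).2 → ¬(σ v).1)

theorem isLocal_forestQ : IsLocal forestQ :=
  isLocal_isBridge.and <| (isLocal_forall_adj (L := Prop) fun a b => ¬(a ∧ b)).and <|
    isLocal_exists_adj (L := Prop) id id

theorem isLocal_rootedQ (α β : Prop) : IsLocal (rootedQ α β) :=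
  isLocal_isBridge.and <| (isLocal_existsUnique_reachable fun a : Prop × Prop => a.2).and <|
    (isLocal_forall_adj fun a b : Prop × Prop => ¬(a.1 ∧ b.1)).and <|
    (isLocal_exists_adj (fun a : Prop × Prop => a.1) fun a => a.1 ∨ (β ∧ a.2)).and <|
    isLocal_label fun a : Prop × Prop => α → a.2 → ¬a.1

theorem isMaximalIndepSet_iff {V : Type} (G : SimpleGraph V) (J : Set V) :
    IsMaximalIndepSet G J ↔
      ∀ v, (∀ u, G.Adj v u → ¬(v ∈ J ∧ u ∈ J)) ∧ (v ∈ J ∨ ∃ u, G.Adj v u ∧ u ∈ J) := by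
  constructor
  · rintro ⟨hI, hM⟩ v
    refine ⟨fun u huv h => hI h.1 h.2 huv, ?_⟩
    by_contra! h
    refine hM (insert v J) ?_ (Set.ssubset_insert h.1)
    rintro x y (rfl | hx) (rfl | hy) hxy
    · exact hxy.ne rfl
    · exact h.2 _ hxy hy
    · exact h.2 _ hxy.symm hx
    · exact hI hx hy hxy
  · intro h
    refine ⟨fun u v hu hv huv => (h u).1 v huv ⟨hu, hv⟩, fun J' hJ' hss => ?_⟩
    obtain ⟨v, hv', hv⟩ := Set.exists_of_ssubset hss
    obtain h' | ⟨u, huv, hu⟩ := (h v).2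
    · exact hv h'
    · exact hJ' hv' (hss.1 hu) huv

theorem iN_eq (n : ℕ) : iN n = count forestQ (Fin n) := by
  refine Nat.card_congr (Equiv.subtypeEquivRight fun p => ?_)
  rw [isMaximalIndepSet_iff, SimpleGraph.isAcyclic_iff_forall_adj_isBridge, ← forall_and]
  rfl

/-- `G` is a tree with root `v` and `J` is an independent set of it that dominates all vertices,
except possibly the root if `β` holds; if `α` holds then the root is not in `J`. -/
def RootedTree (α β : Prop) {V : Type} (v : V) (p : SimpleGraph V × (V → Prop)) : Prop :=
  p.1.IsTree ∧ (∀ x y, p.1.Adj x y → ¬(p.2 x ∧ p.2 y)) ∧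
    (∀ x, p.2 x ∨ (β ∧ x = v) ∨ ∃ u, p.1.Adj x u ∧ p.2 u) ∧ (α → ¬p.2 v)

theorem rootedTree_transport (α β : Prop) {V W : Type} (e : V ≃ W) (v : V)
    (p : SimpleGraph W × (W → Prop)) :
    RootedTree α β v (transport e p) ↔ RootedTree α β (e v) p := by
  have hT : (transport e p).1.IsTree ↔ p.1.IsTree := SimpleGraph.Iso.isTree_iff ⟨e, Iff.rfl⟩
  rw [RootedTree, RootedTree, hT, transport_apply]
  simp [e.surjective.forall, e.surjective.exists]

theorem card_rootedTree_eq (α β : Prop) {V : Type} (v w : V) :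
    Nat.card {p // RootedTree α β v p} = Nat.card {p // RootedTree α β w p} := by
  classical
  refine Nat.card_congr (Equiv.subtypeEquiv (transport (Equiv.swap v w)) fun p => ?_)
  rw [rootedTree_transport, Equiv.swap_apply_right]

theorem connCount_rootedQ (α β : Prop) {V : Type} [Finite V] (v : V) :
    connCount (rootedQ α β) V = Nat.card V * Nat.card {p // RootedTree α β v p} := by
  have := Fintype.ofFinite V
  have h1 : Nat.card (Σ w : V, {p // RootedTree α β w p}) =
      Nat.card V * Nat.card {p // RootedTree α β v p} := by
    rw [Nat.card_sigma, Finset.sum_congr rfl fun w _ => card_rootedTree_eq α β w v]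
    simp
  rw [← h1]
  symm
  refine Nat.card_eq_of_bijective (fun q => ⟨(q.2.1.1, fun x => (q.2.1.2 x, x = q.1)), ?_⟩)
    ⟨?_, ?_⟩
  · obtain ⟨w, ⟨G, J⟩, hT, h1, h2, h3⟩ := q
    refine ⟨fun x => ⟨SimpleGraph.isAcyclic_iff_forall_adj_isBridge.1 hT.isAcyclic (v := x),
      ⟨w, ⟨rfl, hT.connected.preconnected x w⟩, fun y hy => hy.1⟩, h1 x, ?_, ?_⟩, hT.connected⟩
    · exact or_assoc.2 (h2 x)
    · rintro ha rfl
      exact h3 ha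
  · rintro ⟨w, ⟨G, J⟩, h⟩ ⟨w', ⟨G', J'⟩, h'⟩ heq
    simp only [Subtype.mk.injEq, Prod.mk.injEq, funext_iff] at heq
    obtain ⟨rfl, h2⟩ := heq
    have hw : w = w' := (h2 w).2.mp rfl
    subst hw
    have hJ : J = J' := funext fun x => (h2 x).1
    subst hJ
    rfl
  · rintro ⟨⟨G, σ⟩, hQ, hc⟩
    have hne := hc.nonempty.some
    obtain ⟨w, ⟨hw, -⟩, hu⟩ := (hQ hne).2.1
    have hr : ∀ x, (σ x).2 ↔ x = w := fun x =>
      ⟨fun hx => hu x ⟨hx, hc.preconnected _ _⟩, fun h => h ▸ hw⟩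
    refine ⟨⟨w, (G, fun x => (σ x).1), ⟨hc, ?_⟩, fun x => (hQ x).2.2.1, fun x => ?_,
      fun ha => (hQ w).2.2.2.2 ha hw⟩, ?_⟩
    · exact SimpleGraph.isAcyclic_iff_forall_adj_isBridge.2 fun x => (hQ x).1
    · have := (hQ x).2.2.2.1
      rw [hr] at this
      exact or_assoc.1 this
    · refine Subtype.ext (Prod.ext rfl (funext fun x => Prod.ext rfl ?_))
      exact propext (hr x).symm

theorem connCount_forestQ {V : Type} (v : V) :
    connCount forestQ V = Nat.card {p // RootedTree False False v p} := by
  refine Nat.card_congr (Equiv.subtypeEquivRight fun p => ?_)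
  simp only [forestQ, forall_and, RootedTree, SimpleGraph.isTree_iff,
    SimpleGraph.isAcyclic_iff_forall_adj_isBridge]
  simp
  tauto

section Deletion

variable {U : Type}

theorem exists_of_reachable_some (H : SimpleGraph (Option U)) (a : U) (y : Option U)
    (h : H.Reachable (some a) y) :
    (∃ b, y = some b ∧ (H.comap some).Reachable a b) ∨
      ∃ r, H.Adj none (some r) ∧ (H.comap some).Reachable a r := by
  rw [SimpleGraph.reachable_iff_reflTransGen] at h
  induction h with
  | refl => exact Or.inl ⟨a, rfl, SimpleGraph.Reachable.rfl⟩
  | @tail y z _ hyz ih =>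
    rcases ih with ⟨b, rfl, hb⟩ | ih
    · cases z with
      | none => exact Or.inr ⟨b, hyz.symm, hb⟩
      | some c =>
        have : (H.comap some).Adj b c := hyz
        exact Or.inl ⟨c, rfl, hb.trans this.reachable⟩
    · exact Or.inr ih

theorem isTree_option_iff (G : SimpleGraph (Option U)) :
    G.IsTree ↔ ∀ v, (∀ u, (G.comap some).Adj v u → (G.comap some).IsBridge s(v, u)) ∧
      ∃! x, G.Adj none (some x) ∧ (G.comap some).Reachable v x := by
  have lift : ∀ (H : SimpleGraph (Option U)) (a b : U), (H.comap some).Reachable a b →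
      H.Reachable (some a) (some b) :=
    fun H a b h => h.map ⟨some, fun {x y} hxy => hxy⟩
  have hdel : ∀ a b : U, (G.comap some).deleteEdges {s(a, b)} =
      (G.deleteEdges {s(some a, some b)}).comap some := by
    intro a b
    ext x y
    simp [SimpleGraph.deleteEdges_adj]
  have hdel' : ∀ r : U, G.comap some = (G.deleteEdges {s(none, some r)}).comap some := by
    intro r
    ext x y
    simp [SimpleGraph.deleteEdges_adj]
  constructor
  · intro hT v
    have hac : (G.comap some).IsAcyclic := hT.isAcyclic.of_comap Function.Embedding.some
    refine ⟨SimpleGraph.isAcyclic_iff_forall_adj_isBridge.1 hac (v := v), ?_⟩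
    obtain ⟨b, hb, -⟩ | ⟨r, hr, hvr⟩ :=
      exists_of_reachable_some G v none (hT.connected.preconnected _ _)
    · simp at hb
    refine ⟨r, ⟨hr, hvr⟩, ?_⟩
    rintro r' ⟨hr', hvr'⟩
    by_contra hne
    have hbr := SimpleGraph.isAcyclic_iff_forall_adj_isBridge.1 hT.isAcyclic hr
    rw [SimpleGraph.isBridge_iff] at hbr
    apply hbr
    have h1 : (G.comap some).Reachable r' r := hvr'.symm.trans hvr
    rw [hdel' r] at h1
    have h2 : (G.deleteEdges {s(none, some r)}).Adj none (some r') := by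
      simp [SimpleGraph.deleteEdges_adj, hr', hne]
    exact h2.reachable.trans (lift _ _ _ h1)
  · intro h
    have hconn : ∀ x, G.Reachable x none := by
      rintro (_ | v)
      · rfl
      · obtain ⟨r, ⟨hr, hvr⟩, -⟩ := (h v).2
        exact (lift _ _ _ hvr).trans hr.symm.reachable
    have hroot : ∀ r, G.Adj none (some r) → G.IsBridge s(none, some r) := by
      intro r hr
      rw [SimpleGraph.isBridge_iff]
      intro hre
      obtain ⟨b, hb, -⟩ | ⟨r', hr', hrr'⟩ := exists_of_reachable_some _ r none hre.symm
      · simp at hb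
      rw [← hdel'] at hrr'
      have h1 : r' = r := (h r).2.unique ⟨SimpleGraph.deleteEdges_le _ hr', hrr'⟩
        ⟨hr, SimpleGraph.Reachable.rfl⟩
      subst h1
      simp [SimpleGraph.deleteEdges_adj] at hr'
    refine ⟨⟨fun x y => (hconn x).trans (hconn y).symm⟩, ?_⟩
    rw [SimpleGraph.isAcyclic_iff_forall_adj_isBridge]
    rintro (_ | a) (_ | b) hab
    · exact absurd hab (G.irrefl)
    · exact hroot b hab
    · rw [Sym2.eq_swap]
      exact hroot a hab.symm
    · rw [SimpleGraph.isBridge_iff]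
      intro hre
      have hbr := (h a).1 b hab
      rw [SimpleGraph.isBridge_iff, hdel] at hbr
      obtain ⟨c, hc, hbc⟩ | ⟨r, hr, har⟩ := exists_of_reachable_some _ a _ hre
      · rw [Option.some_inj] at hc
        subst hc
        exact hbr hbc
      obtain ⟨c, hc, hbc⟩ | ⟨r', hr', hbr'⟩ := exists_of_reachable_some _ b _ hre.symm
      · rw [Option.some_inj] at hc
        subst hc
        exact hbr hbc.symm
      rw [← hdel] at har hbr'
      have hab' : (G.comap some).Adj a b := hab
      have h1 : r = r' := (h a).2.unique
        ⟨SimpleGraph.deleteEdges_le _ hr, har.mono (SimpleGraph.deleteEdges_le _)⟩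
        ⟨SimpleGraph.deleteEdges_le _ hr',
          hab'.reachable.trans (hbr'.mono (SimpleGraph.deleteEdges_le _))⟩
      subst h1
      rw [← hdel] at hbr
      exact hbr (har.trans hbr'.symm)

/-- The graph obtained from `H` by adding a vertex `none` adjacent to the elements of `R`. -/
def cone (H : SimpleGraph U) (R : U → Prop) : SimpleGraph (Option U) where
  Adj
    | some a, some b => H.Adj a b
    | none, some b => R b
    | some a, none => R a
    | none, none => False
  symm := ⟨by
    rintro (_ | a) (_ | b) h
    · exact h
    · exact h
    · exact h
    · exact H.adj_symm h⟩
  loopless := ⟨by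
    rintro (_ | a) h
    · exact h
    · exact H.irrefl h⟩

theorem card_eq_of_forall_cone (b : Prop) (D : SimpleGraph (Option U) × (Option U → Prop) → Prop)
    (P : SimpleGraph U × (U → Prop × Prop) → Prop)
    (h : ∀ p, (p.2 none ↔ b) →
      (D p ↔ P (p.1.comap some, fun x => (p.2 (some x), p.1.Adj none (some x))))) :
    Nat.card {p // D p ∧ (p.2 none ↔ b)} = Nat.card {q // P q} := by
  refine Nat.card_eq_of_bijective (fun p => ⟨(p.1.1.comap some,
    fun x => (p.1.2 (some x), p.1.1.Adj none (some x))), (h p.1 p.2.2).1 p.2.1⟩) ⟨?_, ?_⟩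
  · rintro ⟨⟨G, J⟩, hD, hb⟩ ⟨⟨G', J'⟩, hD', hb'⟩ heq
    simp only [Subtype.mk.injEq, Prod.mk.injEq, funext_iff] at heq
    obtain ⟨h1, h2⟩ := heq
    refine Subtype.ext (Prod.ext ?_ ?_)
    · have hr : ∀ x, G.Adj none (some x) ↔ G'.Adj none (some x) := fun x => (h2 x).2 ▸ Iff.rfl
      ext (_ | x) (_ | y)
      · simp
      · exact hr y
      · exact (G.adj_comm _ _).trans ((hr x).trans (G'.adj_comm _ _))
      · have : (G.comap some).Adj x y ↔ (G'.comap some).Adj x y := by rw [h1]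
        exact this
    · funext x
      cases x with
      | none => exact propext (hb.trans hb'.symm)
      | some x => exact (h2 x).1
  · rintro ⟨⟨H, σ⟩, hP⟩
    refine ⟨⟨(cone H fun x => (σ x).2, fun x => x.elim b fun x => (σ x).1), ?_, Iff.rfl⟩, ?_⟩
    · rw [h _ Iff.rfl]
      exact hP
    · rfl

theorem card_split {X : Type} [Finite X] (a b : X → Prop) :
    Nat.card {x // a x} = Nat.card {x // a x ∧ b x} + Nat.card {x // a x ∧ ¬b x} := by
  classical
  rw [← Nat.card_congr (Equiv.sumCompl fun x : {x // a x} => b x), Nat.card_sum]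
  exact congrArg₂ _ (Nat.card_congr (Equiv.subtypeSubtypeEquivSubtypeInter a b))
    (Nat.card_congr (Equiv.subtypeSubtypeEquivSubtypeInter a fun x => ¬b x))

theorem card_rootedTree_true_true :
    Nat.card {p // RootedTree True True (none : Option U) p} = count (rootedQ False False) U := by
  rw [count, ← card_eq_of_forall_cone False (RootedTree True True none)]
  · refine Nat.card_congr (Equiv.subtypeEquivRight fun p => ?_)
    simp only [RootedTree]
    tauto
  · rintro ⟨G, J⟩ hb
    simp only [RootedTree, rootedQ, isTree_option_iff, Option.forall, Option.exists, forall_and,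
      SimpleGraph.comap_adj]
    simp only [iff_false] at hb
    simp [hb]
    tauto

theorem card_rootedTree_dominated :
    Nat.card {p : _ × _ // RootedTree True True (none : Option U) p ∧
      ¬∃ u, p.1.Adj none u ∧ p.2 u} = count (rootedQ True False) U := by
  rw [count, ← card_eq_of_forall_cone False (fun p => RootedTree True True none p ∧
      ¬∃ u, p.1.Adj none u ∧ p.2 u)]
  · refine Nat.card_congr (Equiv.subtypeEquivRight fun p => ?_)
    simp only [RootedTree]
    tauto
  · rintro ⟨G, J⟩ hb
    simp only [RootedTree, rootedQ, isTree_option_iff, Option.forall, Option.exists, forall_and,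
      SimpleGraph.comap_adj]
    simp only [iff_false] at hb
    simp [hb]
    tauto

theorem card_rootedTree_mem :
    Nat.card {p : _ × _ // RootedTree False False (none : Option U) p ∧ p.2 none} =
      count (rootedQ True True) U := by
  rw [count, ← card_eq_of_forall_cone True (RootedTree False False none)]
  · refine Nat.card_congr (Equiv.subtypeEquivRight fun p => ?_)
    simp
  · rintro ⟨G, J⟩ hb
    simp only [RootedTree, rootedQ, isTree_option_iff, Option.forall, Option.exists, forall_and,
      SimpleGraph.comap_adj]
    simp only [iff_true] at hb
    simp [hb, G.adj_comm _ none, or_assoc]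
    tauto

theorem card_rootedTree_true_false [Finite U] :
    Nat.card {p // RootedTree True False (none : Option U) p} + count (rootedQ True False) U =
      count (rootedQ False False) U := by
  rw [← card_rootedTree_true_true, ← card_rootedTree_dominated,
    card_split (RootedTree True True (none : Option U)) fun p => ∃ u, p.1.Adj none u ∧ p.2 u]
  congr 1
  refine Nat.card_congr (Equiv.subtypeEquivRight fun p => ?_)
  simp only [RootedTree, Option.forall, reduceCtorEq, and_false, false_or, and_true, true_and]
  tauto

theorem card_rootedTree_false_false [Finite U] :
    Nat.card {p // RootedTree False False (none : Option U) p} =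
      count (rootedQ True True) U + Nat.card {p // RootedTree True False (none : Option U) p} := by
  rw [← card_rootedTree_mem,
    card_split (RootedTree False False (none : Option U)) fun p => p.2 none]
  congr 1
  refine Nat.card_congr (Equiv.subtypeEquivRight fun p => ?_)
  simp only [RootedTree]
  tauto

end Deletion

theorem connCount_true_true (n : ℕ) : connCount (rootedQ True True) (Fin (n + 1)) =
    (n + 1) * count (rootedQ False False) (Fin n) := by
  rw [(isLocal_rootedQ _ _).connCount_congr (finSuccEquiv n), connCount_rootedQ _ _ none,
    card_rootedTree_true_true]
  simp

theorem connCount_true_false (n : ℕ) : connCount (rootedQ True False) (Fin (n + 1)) +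
    (n + 1) * count (rootedQ True False) (Fin n) =
    (n + 1) * count (rootedQ False False) (Fin n) := by
  rw [(isLocal_rootedQ _ _).connCount_congr (finSuccEquiv n), connCount_rootedQ _ _ none,
    ← card_rootedTree_true_false]
  simp [mul_add]

theorem connCount_false_false (n : ℕ) : connCount (rootedQ False False) (Fin (n + 1)) =
    (n + 1) * count (rootedQ True True) (Fin n) + connCount (rootedQ True False) (Fin (n + 1)) := by
  rw [(isLocal_rootedQ _ _).connCount_congr (finSuccEquiv n),
    (isLocal_rootedQ _ _).connCount_congr (finSuccEquiv n), connCount_rootedQ _ _ none,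
    connCount_rootedQ _ _ none, card_rootedTree_false_false]
  simp [mul_add]

theorem mul_connCount_forestQ (n : ℕ) : (n + 1) * connCount forestQ (Fin (n + 1)) =
    connCount (rootedQ False False) (Fin (n + 1)) := by
  rw [connCount_forestQ 0, connCount_rootedQ _ _ 0]
  simp

theorem iteratedDeriv_succ_of_deriv_eq_mul {f s : ℂ → ℂ} (hf : AnalyticAt ℂ f 0)
    (hs : AnalyticAt ℂ s 0) (h : deriv f =ᶠ[𝓝 0] fun x => s x * f x) (n : ℕ) :
    iteratedDeriv (n + 1) f 0 = ∑ i ∈ Finset.range (n + 1),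
      (n.choose i : ℂ) * (iteratedDeriv i s 0 * iteratedDeriv (n - i) f 0) := by
  rw [iteratedDeriv_succ', h.iteratedDeriv_eq, iteratedDeriv_fun_mul hs.contDiffAt hf.contDiffAt]
  simp only [mul_assoc]

theorem iteratedDeriv_succ_id_mul {f : ℂ → ℂ} (hf : AnalyticAt ℂ f 0) (n : ℕ) :
    iteratedDeriv (n + 1) (fun x => x * f x) 0 = (n + 1) * iteratedDeriv n f 0 := by
  rw [iteratedDeriv_fun_mul contDiffAt_fun_id hf.contDiffAt, Finset.sum_eq_single 1]
  · simp [iteratedDeriv_fun_id_zero]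
  · intro b _ hb
    simp [iteratedDeriv_fun_id_zero, hb]
  · simp

variable {E₁ E₂ E₃ F : ℂ → ℂ}

theorem iteratedDeriv_fun_add_sub (a₁ : AnalyticAt ℂ E₁ 0) (a₂ : AnalyticAt ℂ E₂ 0)
    (a₃ : AnalyticAt ℂ E₃ 0) (n : ℕ) : iteratedDeriv n (fun x => E₁ x + E₂ x - E₃ x) 0 =
      iteratedDeriv n E₁ 0 + iteratedDeriv n E₂ 0 - iteratedDeriv n E₃ 0 := by
  rw [iteratedDeriv_fun_sub (f := fun x => E₁ x + E₂ x) (a₁.add a₂).contDiffAt a₃.contDiffAt,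
    iteratedDeriv_fun_add a₁.contDiffAt a₂.contDiffAt]

theorem count_rootedQ_eq_iteratedDeriv (a₁ : AnalyticAt ℂ E₁ 0) (a₂ : AnalyticAt ℂ E₂ 0)
    (a₃ : AnalyticAt ℂ E₃ 0) (i₁ : E₁ 0 = 1) (i₂ : E₂ 0 = 1) (i₃ : E₃ 0 = 1)
    (d₁ : deriv E₁ =ᶠ[𝓝 0] fun x => deriv (fun x => x * E₂ x) x * E₁ x)
    (d₂ : deriv E₂ =ᶠ[𝓝 0] fun x => deriv (fun x => x * (E₁ x + E₂ x - E₃ x)) x * E₂ x)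
    (d₃ : deriv E₃ =ᶠ[𝓝 0] fun x => deriv (fun x => x * (E₂ x - E₃ x)) x * E₃ x) (n : ℕ) :
    (count (rootedQ True True) (Fin n) : ℂ) = iteratedDeriv n E₁ 0 ∧
    (count (rootedQ False False) (Fin n) : ℂ) = iteratedDeriv n E₂ 0 ∧
    (count (rootedQ True False) (Fin n) : ℂ) = iteratedDeriv n E₃ 0 := by
  have a₁₂ : AnalyticAt ℂ (fun x => E₁ x + E₂ x - E₃ x) 0 := (a₁.add a₂).sub a₃
  have a₂₃ : AnalyticAt ℂ (fun x => E₂ x - E₃ x) 0 := a₂.sub a₃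
  have ax : ∀ {f : ℂ → ℂ}, AnalyticAt ℂ f 0 → AnalyticAt ℂ (deriv fun x => x * f x) 0 :=
    fun hf => (analyticAt_id.mul hf).deriv
  induction n using Nat.strong_induction_on with
  | _ n ih =>
    cases n with
    | zero => simp [count_fin_zero, i₁, i₂, i₃]
    | succ n =>
      have key : ∀ k ≤ n,
          (connCount (rootedQ True True) (Fin (k + 1)) : ℂ) =
            iteratedDeriv k (deriv fun x => x * E₂ x) 0 ∧
          (connCount (rootedQ False False) (Fin (k + 1)) : ℂ) =
            iteratedDeriv k (deriv fun x => x * (E₁ x + E₂ x - E₃ x)) 0 ∧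
          (connCount (rootedQ True False) (Fin (k + 1)) : ℂ) =
            iteratedDeriv k (deriv fun x => x * (E₂ x - E₃ x)) 0 := by
        intro k hk
        obtain ⟨h₁, h₂, h₃⟩ := ih k (by omega)
        have e₁ := congrArg (Nat.cast (R := ℂ)) (connCount_true_true k)
        have e₂ := congrArg (Nat.cast (R := ℂ)) (connCount_false_false k)
        have e₃ := congrArg (Nat.cast (R := ℂ)) (connCount_true_false k)
        push_cast at e₁ e₂ e₃
        rw [h₁] at e₂
        rw [h₂] at e₁ e₃
        rw [h₃] at e₃
        simp only [← iteratedDeriv_succ', iteratedDeriv_succ_id_mul a₂,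
          iteratedDeriv_succ_id_mul a₁₂, iteratedDeriv_succ_id_mul a₂₃]
        rw [iteratedDeriv_fun_add_sub a₁ a₂ a₃,
          iteratedDeriv_fun_sub a₂.contDiffAt a₃.contDiffAt]
        refine ⟨e₁, ?_, ?_⟩
        · linear_combination e₂ + e₃
        · linear_combination e₃
      refine ⟨?_, ?_, ?_⟩
      · rw [iteratedDeriv_succ_of_deriv_eq_mul a₁ (ax a₂) d₁,
          (isLocal_rootedQ _ _).count_succ]
        push_cast
        refine Finset.sum_congr rfl fun k hk => ?_
        rw [(key k (by simp at hk; omega)).1, (ih (n - k) (by omega)).1]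
      · rw [iteratedDeriv_succ_of_deriv_eq_mul a₂ (ax a₁₂) d₂,
          (isLocal_rootedQ _ _).count_succ]
        push_cast
        refine Finset.sum_congr rfl fun k hk => ?_
        rw [(key k (by simp at hk; omega)).2.1, (ih (n - k) (by omega)).2.1]
      · rw [iteratedDeriv_succ_of_deriv_eq_mul a₃ (ax a₂₃) d₃,
          (isLocal_rootedQ _ _).count_succ]
        push_cast
        refine Finset.sum_congr rfl fun k hk => ?_
        rw [(key k (by simp at hk; omega)).2.2, (ih (n - k) (by omega)).2.2]

theorem iN_eq_iteratedDeriv (a₁ : AnalyticAt ℂ E₁ 0) (a₂ : AnalyticAt ℂ E₂ 0)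
    (a₃ : AnalyticAt ℂ E₃ 0) (aF : AnalyticAt ℂ F 0)
    (i₁ : E₁ 0 = 1) (i₂ : E₂ 0 = 1) (i₃ : E₃ 0 = 1) (iF : F 0 = 1)
    (d₁ : deriv E₁ =ᶠ[𝓝 0] fun x => deriv (fun x => x * E₂ x) x * E₁ x)
    (d₂ : deriv E₂ =ᶠ[𝓝 0] fun x => deriv (fun x => x * (E₁ x + E₂ x - E₃ x)) x * E₂ x)
    (d₃ : deriv E₃ =ᶠ[𝓝 0] fun x => deriv (fun x => x * (E₂ x - E₃ x)) x * E₃ x)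
    (dF : deriv F =ᶠ[𝓝 0] fun x => (E₁ x + E₂ x - E₃ x) * F x) (n : ℕ) :
    (iN n : ℂ) = iteratedDeriv n F 0 := by
  rw [iN_eq]
  have a₁₂ : AnalyticAt ℂ (fun x => E₁ x + E₂ x - E₃ x) 0 := (a₁.add a₂).sub a₃
  induction n using Nat.strong_induction_on with
  | _ n ih =>
    cases n with
    | zero => simp [count_fin_zero, iF]
    | succ n =>
      rw [iteratedDeriv_succ_of_deriv_eq_mul aF a₁₂ dF, isLocal_forestQ.count_succ]
      push_cast
      refine Finset.sum_congr rfl fun k hk => ?_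
      rw [ih (n - k) (by omega)]
      congr 2
      obtain ⟨h₁, h₂, h₃⟩ := count_rootedQ_eq_iteratedDeriv a₁ a₂ a₃ i₁ i₂ i₃ d₁ d₂ d₃ k
      have e₁ := congrArg (Nat.cast (R := ℂ)) (mul_connCount_forestQ k)
      have e₂ := congrArg (Nat.cast (R := ℂ)) (connCount_false_false k)
      have e₃ := congrArg (Nat.cast (R := ℂ)) (connCount_true_false k)
      push_cast at e₁ e₂ e₃
      rw [iteratedDeriv_fun_add_sub a₁ a₂ a₃, ← h₁, ← h₂, ← h₃]
      refine mul_left_cancel₀ (Nat.cast_add_one_ne_zero k) ?_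
      linear_combination e₁ + e₂ + e₃

section Lagrange

variable {h h' : ℂ → ℂ} {U : Set ℂ} {r : ℝ}

theorem circleIntegral_deriv_div_pow (hd : ∀ u, HasDerivAt h (h' u) u) (hr : 0 < r)
    (h₀ : ∀ u ≠ 0, h u ≠ 0) (n : ℕ) : (∮ u in C(0, r), h' u / h u ^ (n + 2)) = 0 := by
  have key : ∀ u ∈ Metric.sphere (0 : ℂ) r,
      HasDerivWithinAt (fun u => -((n : ℂ) + 1)⁻¹ * (h u ^ (n + 1))⁻¹) (h' u / h u ^ (n + 2))
        (Metric.sphere 0 r) u := by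
    intro u hu
    have hu0 : h u ≠ 0 := h₀ u (ne_zero_of_mem_sphere hr.ne' ⟨u, hu⟩)
    have hn : (n : ℂ) + 1 ≠ 0 := Nat.cast_add_one_ne_zero n
    refine ((((hd u).fun_pow (n + 1)).fun_inv (pow_ne_zero _ hu0)).const_mul
      (-((n : ℂ) + 1)⁻¹)).hasDerivWithinAt.congr_deriv ?_
    push_cast
    field_simp
    ring
  exact circleIntegral.integral_eq_zero_of_hasDerivWithinAt hr.le key

theorem lagrange_circleIntegral {w : ℂ → ℂ} (hw : Differentiable ℂ w) (hw₀ : ∀ u, w u ≠ 0)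
    (hh : ∀ u, h u = u * w u) (hd : ∀ u, HasDerivAt h (h' u) u) (hr : 0 < r) (hU : IsOpen U)
    (hrU : ∀ u ∈ Metric.closedBall (0 : ℂ) r, h u ∈ U) (n : ℕ) (F : ℂ → ℂ)
    (hF : DifferentiableOn ℂ F U) :
    (∮ u in C(0, r), F (h u) * h' u / h u ^ (n + 1)) =
      2 * Real.pi * Complex.I * (iteratedDeriv n F 0 / n.factorial) := by
  have h0 : h 0 = 0 := by simp [hh]
  have hU0 : (0 : ℂ) ∈ U := h0 ▸ hrU 0 (by simp [hr.le])
  have hne : ∀ u ≠ 0, h u ≠ 0 := fun u hu => by rw [hh]; exact mul_ne_zero hu (hw₀ u)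
  have hdiff : Differentiable ℂ h := fun u => (hd u).differentiableAt
  have hd' : h' = deriv h := funext fun u => (hd u).deriv.symm
  have hdiff' : Differentiable ℂ h' := by
    rw [hd']
    exact fun u => (hdiff.analyticAt u).deriv.differentiableAt
  have hFh : ∀ F : ℂ → ℂ, DifferentiableOn ℂ F U →
      DifferentiableOn ℂ (fun u => F (h u)) (Metric.closedBall 0 r) := fun F hF =>
    hF.comp hdiff.differentiableOn hrU
  induction n generalizing F with
  | zero =>
    have hw' : h' 0 = w 0 := by
      have : HasDerivAt h (1 * w 0 + 0 * deriv w 0) 0 := by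
        have := (hasDerivAt_id (0 : ℂ)).fun_mul (hw 0).hasDerivAt
        exact this.congr_of_eventuallyEq (Eventually.of_forall fun u => hh u)
      simpa using (hd 0).unique this
    have hD : DifferentiableOn ℂ (fun u => F (h u) * h' u * (w u)⁻¹) (Metric.closedBall 0 r) :=
      ((hFh F hF).mul hdiff'.differentiableOn).mul (hw.differentiableOn.inv fun u _ => hw₀ u)
    have key := hD.circleIntegral_sub_inv_smul (w := 0) (by simpa using hr)
    have e : (∮ u in C(0, r), F (h u) * h' u / h u ^ (0 + 1)) =
        ∮ u in C(0, r), (u - 0)⁻¹ • (F (h u) * h' u * (w u)⁻¹) := by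
      refine circleIntegral.integral_congr hr.le fun u _ => ?_
      simp only [hh u, sub_zero, smul_eq_mul, zero_add, pow_one, div_eq_mul_inv, mul_inv]
      ring
    rw [e, key]
    simp [h0, hw', hw₀ 0]
  | succ n ih =>
    have hF' : DifferentiableOn ℂ (dslope F 0) U :=
      (Complex.differentiableOn_dslope (hU.mem_nhds hU0)).2 hF
    have hFeq : ∀ x, F x = F 0 + x * dslope F 0 x := fun x => by
      have := sub_smul_dslope F 0 x
      simp only [sub_zero, smul_eq_mul] at this
      rw [this]
      ring
    have hana : AnalyticAt ℂ (dslope F 0) 0 := hF'.analyticAt (hU.mem_nhds hU0)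
    have hid : iteratedDeriv (n + 1) F 0 = (n + 1) * iteratedDeriv n (dslope F 0) 0 := by
      rw [← iteratedDeriv_succ_id_mul hana, ← iteratedDeriv_const_add
        (f := fun x => x * dslope F 0 x) (Nat.succ_pos n) (F 0)]
      exact congrArg (fun f => iteratedDeriv (n + 1) f 0) (funext hFeq)
    have hsph : ∀ u ∈ Metric.sphere (0 : ℂ) r, h u ≠ 0 := fun u hu =>
      hne u (ne_zero_of_mem_sphere hr.ne' ⟨u, hu⟩)
    have hc : ∀ (f : ℂ → ℂ) (m : ℕ), ContinuousOn f (Metric.closedBall 0 r) →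
        CircleIntegrable (fun u => f u / h u ^ m) 0 r := fun f m hf =>
      ContinuousOn.circleIntegrable hr.le ((hf.mono Metric.sphere_subset_closedBall).div
        (hdiff.continuous.continuousOn.pow m) fun u hu => pow_ne_zero _ (hsph u hu))
    have e : (∮ u in C(0, r), F (h u) * h' u / h u ^ (n + 1 + 1)) =
        (∮ u in C(0, r), F 0 * (h' u / h u ^ (n + 2))) +
          ∮ u in C(0, r), dslope F 0 (h u) * h' u / h u ^ (n + 1) := by
      rw [← circleIntegral.integral_add]
      · refine circleIntegral.integral_congr hr.le fun u hu => ?_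
        have := hsph u hu
        rw [hFeq (h u)]
        field_simp
        ring
      · simpa only [mul_div_assoc] using hc (fun u => F 0 * h' u) (n + 2)
          (hdiff'.continuous.const_mul _).continuousOn
      · exact hc _ _ ((hFh _ hF').continuousOn.mul hdiff'.continuous.continuousOn)
    rw [e, circleIntegral.integral_const_mul, circleIntegral_deriv_div_pow hd hr hne, ih _ hF', hid,
      Nat.factorial_succ]
    have : (n : ℂ) + 1 ≠ 0 := Nat.cast_add_one_ne_zero n
    push_cast
    field_simp
    ring

theorem circleIntegral_by_parts {G G' : ℂ → ℂ} (hG : ∀ u, HasDerivAt G (G' u) u)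
    (hG' : Continuous G') (hh' : Continuous h') (hd : ∀ u, HasDerivAt h (h' u) u) (hr : 0 < r)
    (h₀ : ∀ u ≠ 0, h u ≠ 0) (n : ℕ) :
    n * (∮ u in C(0, r), G u * h' u / h u ^ (n + 1)) = ∮ u in C(0, r), G' u / h u ^ n := by
  have hsph : ∀ u ∈ Metric.sphere (0 : ℂ) r, h u ≠ 0 := fun u hu =>
    h₀ u (ne_zero_of_mem_sphere hr.ne' ⟨u, hu⟩)
  have key : ∀ u ∈ Metric.sphere (0 : ℂ) r, HasDerivWithinAt (fun u => G u * (h u ^ n)⁻¹)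
      (G' u / h u ^ n - n * (G u * h' u / h u ^ (n + 1))) (Metric.sphere 0 r) u := by
    intro u hu
    have hu0 := hsph u hu
    refine ((hG u).fun_mul (((hd u).fun_pow n).fun_inv
      (pow_ne_zero _ hu0))).hasDerivWithinAt.congr_deriv ?_
    cases n with
    | zero => simp
    | succ n =>
      simp only [Nat.add_sub_cancel]
      field_simp
      ring
  have hhc : Continuous h := continuous_iff_continuousAt.2 fun u => (hd u).continuousAt
  have hGc : Continuous G := continuous_iff_continuousAt.2 fun u => (hG u).continuousAt
  have hc : ∀ (f : ℂ → ℂ) (m : ℕ), Continuous f →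
      CircleIntegrable (fun u => f u / h u ^ m) 0 r := fun f m hf =>
    ContinuousOn.circleIntegrable hr.le (hf.continuousOn.div
      (hhc.continuousOn.pow m) fun u hu => pow_ne_zero _ (hsph u hu))
  have e := circleIntegral.integral_eq_zero_of_hasDerivWithinAt hr.le key
  rw [circleIntegral.integral_sub (hc _ _ hG') (by
    simpa only [mul_div_assoc] using hc (fun u => n * (G u * h' u)) (n + 1)
      ((hGc.mul hh').const_mul _)), circleIntegral.integral_const_mul] at e
  exact (sub_eq_zero.1 e).symm

theorem circleIntegral_radius_eq {f : ℂ → ℂ} {R : ℝ} (hr : 0 < r) (hR : 0 < R)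
    (hf : ∀ u ≠ 0, DifferentiableAt ℂ f u) : (∮ u in C(0, r), f u) = ∮ u in C(0, R), f u := by
  wlog hrR : r ≤ R generalizing r R
  · exact (this hR hr (le_of_not_ge hrR)).symm
  have hne : ∀ u ∉ Metric.ball (0 : ℂ) r, u ≠ 0 := fun u hu h0 =>
    hu (h0 ▸ Metric.mem_ball_self hr)
  exact (Complex.circleIntegral_eq_of_differentiable_on_annulus_off_countable hr hrR
    Set.countable_empty
    (fun u hu => (hf u (hne u hu.2)).continuousAt.continuousWithinAt)
    (fun u hu => hf u (hne u fun h => hu.1.2 (Metric.ball_subset_closedBall h)))).symm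

end Lagrange

section Functions

/-- `A u = u * exp u`. -/
noncomputable def fA (u : ℂ) : ℂ := u * Complex.exp u

/-- The function whose graph parametrises the rooted generating functions: the inverse of
`u * exp (-fB u)` is the exponential generating function of rooted trees with a maximal
independent set that contains a neighbour of the root. -/
noncomputable def fB (u : ℂ) : ℂ := u * (Complex.exp (fA u) - 1)

noncomputable def fA' (u : ℂ) : ℂ := Complex.exp u * (1 + u)

noncomputable def fB' (u : ℂ) : ℂ := Complex.exp (fA u) - 1 + u * (Complex.exp (fA u) * fA' u)

noncomputable def fh (u : ℂ) : ℂ := u * Complex.exp (-fB u)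

noncomputable def fh' (u : ℂ) : ℂ := Complex.exp (-fB u) * (1 - u * fB' u)

/-- The logarithm of the generating function of forests, in the variable `u`. -/
noncomputable def fH (u : ℂ) : ℂ := fA u + fB u - fA u * (fB u + u) - fB u ^ 2 / 2

noncomputable def fH' (u : ℂ) : ℂ := (Complex.exp u + Complex.exp (fA u) - 1) * (1 - u * fB' u)

noncomputable def fG (u : ℂ) : ℂ := (fA u + fB u) * Complex.exp (fH u)

noncomputable def fG' (u : ℂ) : ℂ :=
  (fA' u + fB' u + (fA u + fB u) * fH' u) * Complex.exp (fH u)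

theorem hasDerivAt_fA (u : ℂ) : HasDerivAt fA (fA' u) u :=
  ((hasDerivAt_id u).fun_mul (Complex.hasDerivAt_exp u)).congr_deriv (by simp [fA']; ring)

theorem hasDerivAt_fB (u : ℂ) : HasDerivAt fB (fB' u) u :=
  ((hasDerivAt_id u).fun_mul ((hasDerivAt_fA u).cexp.sub_const 1)).congr_deriv (by simp [fB'])

theorem hasDerivAt_fh (u : ℂ) : HasDerivAt fh (fh' u) u :=
  ((hasDerivAt_id u).fun_mul (hasDerivAt_fB u).fun_neg.cexp).congr_deriv
    (by simp [fh']; ring)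

theorem hasDerivAt_fH (u : ℂ) : HasDerivAt fH (fH' u) u := by
  have hA := hasDerivAt_fA u
  have hB := hasDerivAt_fB u
  refine (((hA.fun_add hB).fun_sub (hA.fun_mul (hB.fun_add (hasDerivAt_id u)))).fun_sub
    ((hB.fun_pow 2).div_const 2)).congr_deriv ?_
  simp only [fH', fB', fA', fB, fA, id]
  push_cast
  ring

theorem hasDerivAt_fG (u : ℂ) : HasDerivAt fG (fG' u) u :=
  (((hasDerivAt_fA u).fun_add (hasDerivAt_fB u)).fun_mul (hasDerivAt_fH u).cexp).congr_deriv
    (by simp only [fG']; ring)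

theorem differentiable_fA : Differentiable ℂ fA := fun u => (hasDerivAt_fA u).differentiableAt

theorem differentiable_fB : Differentiable ℂ fB := fun u => (hasDerivAt_fB u).differentiableAt

theorem differentiable_fh : Differentiable ℂ fh := fun u => (hasDerivAt_fh u).differentiableAt

theorem differentiable_fH : Differentiable ℂ fH := fun u => (hasDerivAt_fH u).differentiableAt

theorem differentiable_of_hasDerivAt {f f' : ℂ → ℂ} (hf : ∀ u, HasDerivAt f (f' u) u) :
    Differentiable ℂ f' := by
  have hd : Differentiable ℂ f := fun u => (hf u).differentiableAt
  rw [show f' = deriv f from funext fun u => (hf u).deriv.symm]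
  exact fun u => (hd.analyticAt u).deriv.differentiableAt

theorem fh_ne_zero {u : ℂ} (hu : u ≠ 0) : fh u ≠ 0 := mul_ne_zero hu (Complex.exp_ne_zero _)

theorem fh_zero : fh 0 = 0 := by simp [fh]

theorem fh'_zero : fh' 0 = 1 := by simp [fh', fB]

theorem exists_inverse_fh : ∃ c : ℂ → ℂ, AnalyticAt ℂ c 0 ∧ c 0 = 0 ∧
    (∀ᶠ u in 𝓝 0, c (fh u) = u) ∧ ∀ᶠ x in 𝓝 0, fh (c x) = x := by
  have ha : AnalyticAt ℂ fh 0 := differentiable_fh.analyticAt 0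
  have h1 : deriv fh 0 ≠ 0 := by rw [(hasDerivAt_fh 0).deriv, fh'_zero]; exact one_ne_zero
  have hl := HasStrictDerivAt.eventually_left_inverse ha.hasStrictDerivAt h1
  have hr := HasStrictDerivAt.eventually_right_inverse ha.hasStrictDerivAt h1
  have hc := ha.analyticAt_localInverse h1
  rw [fh_zero] at hr hc
  refine ⟨_, hc, ?_, hl, hr⟩
  have := hl.self_of_nhds
  rwa [fh_zero] at this

theorem deriv_exp_comp_eventuallyEq {f g : ℂ → ℂ} (hf : AnalyticAt ℂ f 0) (hfg : f =ᶠ[𝓝 0] g) :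
    deriv (fun x => Complex.exp (f x)) =ᶠ[𝓝 0] fun x => deriv g x * Complex.exp (f x) := by
  filter_upwards [hf.eventually_analyticAt, hfg.deriv] with x hx hx'
  rw [hx.differentiableAt.hasDerivAt.cexp.deriv, hx', mul_comm]

/-- In the variable `u`, the exponential generating function of pairs of a forest and a maximal
independent set is `exp ∘ fH`. -/
theorem exists_egf : ∃ F : ℂ → ℂ, AnalyticAt ℂ F 0 ∧
    (∀ᶠ u in 𝓝 0, F (fh u) = Complex.exp (fH u)) ∧ ∀ n, (iN n : ℂ) = iteratedDeriv n F 0 := by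
  obtain ⟨c, hc, hc0, hl, hr⟩ := exists_inverse_fh
  have hcomp : ∀ {f : ℂ → ℂ}, Differentiable ℂ f → AnalyticAt ℂ (fun x => f (c x)) 0 :=
    fun hf => (hf.analyticAt (c 0)).comp hc
  have hA := hcomp differentiable_fA
  have hB := hcomp differentiable_fB
  have hH := hcomp differentiable_fH
  have hx : ∀ᶠ x in 𝓝 0, x * Complex.exp (fB (c x)) = c x := by
    filter_upwards [hr] with x hx
    have hx' : c x * Complex.exp (-fB (c x)) = x := hx
    nth_rewrite 1 [← hx']
    rw [mul_assoc, ← Complex.exp_add]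
    simp
  refine ⟨fun x => Complex.exp (fH (c x)), hH.cexp, hl.mono fun u hu => by simp only [hu], ?_⟩
  refine iN_eq_iteratedDeriv (E₁ := fun x => Complex.exp (fB (c x) + c x))
    (E₂ := fun x => Complex.exp (fA (c x) + fB (c x))) (E₃ := fun x => Complex.exp (fB (c x)))
    (hB.add hc).cexp (hA.add hB).cexp hB.cexp hH.cexp
    (by simp [hc0, fB]) (by simp [hc0, fB, fA]) (by simp [hc0, fB]) (by simp [hc0, fH, fA, fB])
    (deriv_exp_comp_eventuallyEq (hB.add hc) ?_) (deriv_exp_comp_eventuallyEq (hA.add hB) ?_)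
    (deriv_exp_comp_eventuallyEq hB ?_) ?_
  · filter_upwards [hx] with x hx
    rw [Complex.exp_add]
    nth_rewrite 1 [fB]
    linear_combination -Complex.exp (fA (c x)) * hx
  · filter_upwards [hx] with x hx
    simp only [Complex.exp_add]
    nth_rewrite 1 [fB]
    nth_rewrite 1 [fA]
    linear_combination -(Complex.exp (c x) + Complex.exp (fA (c x)) - 1) * hx
  · filter_upwards [hx] with x hx
    rw [Complex.exp_add]
    nth_rewrite 1 [fB]
    linear_combination -(Complex.exp (fA (c x)) - 1) * hx
  · filter_upwards [hc.eventually_analyticAt, hr.eventually_nhds] with x hcx hrx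
    have d := hcx.differentiableAt.hasDerivAt
    have d1 : fh' (c x) * deriv c x = 1 :=
      ((hasDerivAt_fh (c x)).comp x d).unique ((hasDerivAt_id x).congr_of_eventuallyEq hrx)
    have d2 := ((hasDerivAt_fH (c x)).comp x d).cexp.deriv
    simp only [Function.comp_apply] at d2
    rw [d2, Complex.exp_add, Complex.exp_add, fH']
    rw [fh', Complex.exp_neg] at d1
    have h0 := Complex.exp_ne_zero (fB (c x))
    field_simp at d1
    linear_combination (Complex.exp (c x) + Complex.exp (fA (c x)) - 1) *
      Complex.exp (fH (c x)) * d1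

theorem sq_mul_iN_eq_circleIntegral {r : ℝ} (hr : 0 < r) (n : ℕ) :
    (n : ℂ) ^ 2 * (2 * Real.pi * Complex.I * (iN n / n.factorial)) =
      ∮ u in C(0, r), fG' u / fh u ^ n := by
  obtain ⟨F, hF, hFh, hn⟩ := exists_egf
  obtain ⟨U, hUs, hU, hU0⟩ := mem_nhds_iff.1 hF.eventually_analyticAt
  have hU' : ∀ᶠ u in 𝓝 0, fh u ∈ U ∧ F (fh u) = Complex.exp (fH u) :=
    ((differentiable_fh.continuous.tendsto 0).eventually
      (fh_zero.symm ▸ hU.mem_nhds hU0)).and hFh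
  obtain ⟨s, hs, hsU⟩ := Metric.nhds_basis_closedBall.eventually_iff.1 hU'
  have hdh := differentiable_of_hasDerivAt hasDerivAt_fh
  have hdH := differentiable_of_hasDerivAt hasDerivAt_fH
  have hdG := differentiable_of_hasDerivAt hasDerivAt_fG
  have h₀ : ∀ u ≠ 0, fh u ≠ 0 := fun u hu => fh_ne_zero hu
  have key := lagrange_circleIntegral (h := fh) (w := fun u => Complex.exp (-fB u))
    differentiable_fB.neg.cexp (fun _ => Complex.exp_ne_zero _) (fun _ => rfl) hasDerivAt_fh hs hU
    (fun u hu => (hsU hu).1) n F (fun x hx => (hUs hx).differentiableAt.differentiableWithinAt)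
  have e₀ : (∮ u in C(0, r), fG' u / fh u ^ n) = ∮ u in C(0, s), fG' u / fh u ^ n :=
    circleIntegral_radius_eq hr hs fun u hu => (hdG u).div
      ((differentiable_fh u).pow n) (pow_ne_zero n (h₀ u hu))
  rw [hn, ← key, e₀,
    ← circleIntegral_by_parts hasDerivAt_fG hdG.continuous hdh.continuous hasDerivAt_fh hs h₀, sq,
    mul_assoc]
  congr 1
  have e₁ : (∮ u in C(0, s), F (fh u) * fh' u / fh u ^ (n + 1)) =
      ∮ u in C(0, s), Complex.exp (fH u) * fh' u / fh u ^ (n + 1) :=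
    circleIntegral.integral_congr hs.le fun u hu => by
      simp only [(hsU (Metric.sphere_subset_closedBall hu)).2]
  rw [e₁, circleIntegral_by_parts (G' := fun u => Complex.exp (fH u) * fH' u)
    (fun u => (hasDerivAt_fH u).cexp)
    (differentiable_fH.continuous.cexp.mul hdH.continuous) hdh.continuous hasDerivAt_fh hs h₀]
  refine circleIntegral.integral_congr hs.le fun u hu => ?_
  have hu0 : u ≠ 0 := ne_zero_of_mem_sphere hs.ne' ⟨u, hu⟩
  simp only [pow_succ, fG, fH', fh']
  rw [div_eq_div_iff (pow_ne_zero _ (h₀ u hu0)) (mul_ne_zero (pow_ne_zero _ (h₀ u hu0)) (h₀ u hu0))]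
  simp only [fA, fB, fh]
  ring

end Functions

section Laplace

/-- Laplace's method for a complex phase on `[-π, π]`. -/
theorem tendsto_sqrt_mul_integral_exp {K φ : ℝ → ℂ} {c : ℝ} {d : ℂ} (hK : Continuous K)
    (hφ : Continuous φ) (hc : 0 < c)
    (hle : ∀ θ ∈ Set.Icc (-Real.pi) Real.pi, (φ θ).re ≤ -c * θ ^ 2) {e : ℝ → ℂ}
    (he : Continuous e) (he0 : e 0 = d) (hφe : ∀ θ, φ θ = -e θ * θ ^ 2) (hd : 0 < d.re) :
    Tendsto (fun n : ℕ => (Real.sqrt n : ℂ) *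
      ∫ θ in (-Real.pi)..Real.pi, K θ * Complex.exp (n * φ θ)) atTop
      (𝓝 (K 0 * (Real.pi / d) ^ (1 / 2 : ℂ))) := by
  obtain ⟨M, hM⟩ := isCompact_Icc.exists_bound_of_continuousOn
    (s := Set.Icc (-Real.pi) Real.pi) hK.continuousOn
  have hM0 : 0 ≤ M := (norm_nonneg _).trans (hM 0 ⟨by simp [Real.pi_pos.le], Real.pi_pos.le⟩)
  let f : ℕ → ℝ → ℂ := fun n => Set.indicator
    (Set.Ioc (-Real.pi * Real.sqrt n) (Real.pi * Real.sqrt n))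
    fun t => K (t / Real.sqrt n) * Complex.exp (n * φ (t / Real.sqrt n))
  have hf : ∀ᶠ n : ℕ in atTop, (Real.sqrt n : ℂ) *
      (∫ θ in (-Real.pi)..Real.pi, K θ * Complex.exp (n * φ θ)) = ∫ t, f n t := by
    filter_upwards [eventually_gt_atTop 0] with n hn
    have hs : 0 < Real.sqrt n := Real.sqrt_pos.2 (by exact_mod_cast hn)
    have hle : -Real.pi * Real.sqrt n ≤ Real.pi * Real.sqrt n := by nlinarith [Real.pi_pos]
    rw [integral_indicator measurableSet_Ioc, ← intervalIntegral.integral_of_le hle,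
      intervalIntegral.integral_comp_div (fun θ : ℝ => K θ * Complex.exp (n * φ θ)) hs.ne',
      mul_div_cancel_right₀ _ hs.ne', mul_div_cancel_right₀ _ hs.ne']
    simp
  refine Tendsto.congr' (hf.mono fun _ h => h.symm) ?_
  rw [← integral_gaussian_complex hd, ← integral_const_mul]
  refine tendsto_integral_filter_of_dominated_convergence
    (fun t => M * Real.exp (-c * t ^ 2)) ?_ ?_ ((integrable_exp_neg_mul_sq hc).const_mul M) ?_
  · refine Eventually.of_forall fun n => ?_
    have : Continuous fun t : ℝ => K (t / Real.sqrt n) * Complex.exp (n * φ (t / Real.sqrt n)) := by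
      fun_prop
    exact this.aestronglyMeasurable.indicator measurableSet_Ioc
  · filter_upwards [eventually_gt_atTop 0] with n hn
    have hs : 0 < Real.sqrt n := Real.sqrt_pos.2 (by exact_mod_cast hn)
    refine Eventually.of_forall fun t => ?_
    by_cases ht : t ∈ Set.Ioc (-Real.pi * Real.sqrt n) (Real.pi * Real.sqrt n)
    · have hmem : t / Real.sqrt n ∈ Set.Icc (-Real.pi) Real.pi :=
        ⟨(le_div_iff₀ hs).2 ht.1.le, (div_le_iff₀ hs).2 ht.2⟩
      simp only [f, Set.indicator_of_mem ht, norm_mul, Complex.norm_exp]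
      refine mul_le_mul (hM _ hmem) (Real.exp_le_exp.2 ?_) (Real.exp_pos _).le hM0
      have h1 := mul_le_mul_of_nonneg_left (hle _ hmem) (Nat.cast_nonneg n)
      have h2 : (n : ℝ) * (-c * (t / Real.sqrt n) ^ 2) = -c * t ^ 2 := by
        rw [div_pow, Real.sq_sqrt (Nat.cast_nonneg n)]
        field_simp
      rw [h2] at h1
      simpa using h1
    · simp only [f, Set.indicator_of_notMem ht, norm_zero]
      positivity
  · refine Eventually.of_forall fun t => ?_
    have hsq : Tendsto (fun n : ℕ => Real.sqrt n) atTop atTop :=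
      Real.tendsto_sqrt_atTop.comp tendsto_natCast_atTop_atTop
    have ht0 : Tendsto (fun n : ℕ => t / Real.sqrt n) atTop (𝓝 0) :=
      Tendsto.div_atTop tendsto_const_nhds hsq
    have hlim : Tendsto (fun n : ℕ => K (t / Real.sqrt n) *
        Complex.exp (-e (t / Real.sqrt n) * t ^ 2)) atTop
        (𝓝 (K 0 * Complex.exp (-d * t ^ 2))) := by
      have h1 := (hK.tendsto 0).comp ht0
      have h2 := (he.tendsto 0).comp ht0
      rw [he0] at h2
      exact h1.mul ((h2.neg.mul_const _).cexp)
    refine hlim.congr' ?_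
    filter_upwards [eventually_gt_atTop 0,
      (hsq.const_mul_atTop Real.pi_pos).eventually_gt_atTop |t|] with n hn hnt
    have ht : t ∈ Set.Ioc (-Real.pi * Real.sqrt n) (Real.pi * Real.sqrt n) :=
      ⟨by linarith [neg_abs_le t], (le_abs_self t).trans hnt.le⟩
    have hn' : (n : ℂ) ≠ 0 := by exact_mod_cast hn.ne'
    have hs2 : (Real.sqrt n : ℂ) ^ 2 = n := by
      exact_mod_cast Real.sq_sqrt (Nat.cast_nonneg n)
    simp only [f, Set.indicator_of_mem ht, hφe]
    congr 2
    push_cast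
    rw [div_pow, hs2]
    field_simp

end Laplace

section SaddlePoint

/-- The restriction of `fB` to the real line. -/
noncomputable def rB (x : ℝ) : ℝ := x * (Real.exp (x * Real.exp x) - 1)

theorem fB_ofReal (x : ℝ) : fB x = rB x := by simp [fB, fA, rB]

theorem exists_saddle : ∃ τ : ℝ, 0 < τ ∧ τ ≤ 1 ∧ (τ : ℂ) * fB' τ = 1 := by
  let p : ℝ → ℝ := fun x => x * (Real.exp (x * Real.exp x) - 1 +
    x * (Real.exp (x * Real.exp x) * (Real.exp x * (1 + x))))
  have hp : Continuous p := by fun_prop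
  have h1 : 1 ≤ p 1 := by
    have ha := Real.add_one_le_exp 1
    have hb := Real.add_one_le_exp (Real.exp 1)
    simp only [p, one_mul]
    nlinarith
  have h0 : p 0 ≤ 1 := by simp [p]
  obtain ⟨τ, ⟨hτ0, hτ1⟩, hτ⟩ := intermediate_value_Icc zero_le_one hp.continuousOn ⟨h0, h1⟩
  refine ⟨τ, lt_of_le_of_ne hτ0 ?_, hτ1, ?_⟩
  · rintro rfl
    simp [p] at hτ
  · have := congrArg (Complex.ofReal) hτ
    simp only [p] at this
    push_cast at this
    simpa only [fB', fA', fA] using this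

theorem mul_exp_neg_rB_lt {τ : ℝ} (hτ : 0 < τ) : τ * Real.exp (-rB τ) < Real.exp (-1) := by
  have h1 : τ ^ 2 + 3 / 2 * τ ^ 3 ≤ rB τ := by
    have ha : τ + τ ^ 2 ≤ τ * Real.exp τ := by nlinarith [Real.add_one_le_exp τ]
    have hb := Real.quadratic_le_exp_of_nonneg (x := τ * Real.exp τ) (by positivity)
    have hc : τ ^ 2 ≤ (τ * Real.exp τ) ^ 2 := pow_le_pow_left₀ hτ.le (by nlinarith) 2
    have hd : τ + 3 / 2 * τ ^ 2 ≤ Real.exp (τ * Real.exp τ) - 1 := by linarith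
    have := mul_le_mul_of_nonneg_left hd hτ.le
    simp only [rB]
    linarith
  have h2 : 2 * τ < rB τ + Real.log 2 := by
    have := Real.log_two_gt_d9
    nlinarith [mul_nonneg hτ.le (sq_nonneg (τ - 12 / 25)), sq_nonneg (τ - 12 / 25)]
  have h3 := Real.add_one_le_exp (rB τ - 1 + Real.log 2)
  rw [Real.exp_add, Real.exp_log two_pos] at h3
  have h4 : τ < Real.exp (rB τ - 1) := by linarith
  calc τ * Real.exp (-rB τ) < Real.exp (rB τ - 1) * Real.exp (-rB τ) := by gcongr
    _ = Real.exp (-1) := by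
      rw [← Real.exp_add]
      ring_nf

theorem norm_exp_sub_one_sub_le (z : ℂ) {x : ℝ} (hz : ‖z‖ ≤ x) :
    ‖Complex.exp z - 1 - z‖ ≤ Real.exp x - 1 - x := by
  have h := Complex.norm_exp_sub_sum_le_exp_norm_sub_sum z 2
  simp only [Finset.sum_range_succ, Finset.sum_range_zero, pow_zero, pow_one, Nat.factorial,
    Nat.cast_one, div_one, zero_add, mul_one] at h
  have h2 : Real.exp ‖z‖ - ‖z‖ ≤ Real.exp x - x := by
    have := Real.add_one_le_exp (x - ‖z‖)
    have h3 : Real.exp x = Real.exp ‖z‖ * Real.exp (x - ‖z‖) := by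
      rw [← Real.exp_add]
      ring_nf
    nlinarith [Real.add_one_le_exp ‖z‖, norm_nonneg z]
  rw [sub_sub]
  linarith

theorem norm_fB_sub_le (z : ℂ) :
    ‖fB z - z ^ 2 - z ^ 3‖ ≤ rB ‖z‖ - ‖z‖ ^ 2 - ‖z‖ ^ 3 := by
  have hA : ‖fA z‖ ≤ ‖z‖ * Real.exp ‖z‖ := by
    rw [fA, norm_mul]
    gcongr
    exact Complex.norm_exp_le_exp_norm z
  have e : fB z - z ^ 2 - z ^ 3 = z * (Complex.exp (fA z) - 1 - fA z) +
      z ^ 2 * (Complex.exp z - 1 - z) := by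
    rw [fB]
    nth_rewrite 3 [fA]
    ring
  rw [e]
  refine (norm_add_le _ _).trans ?_
  rw [norm_mul, norm_mul, norm_pow]
  have h1 := mul_le_mul_of_nonneg_left (norm_exp_sub_one_sub_le (fA z) hA) (norm_nonneg z)
  have h2 := mul_le_mul_of_nonneg_left (norm_exp_sub_one_sub_le z le_rfl) (sq_nonneg ‖z‖)
  simp only [rB]
  linarith

theorem re_fB_circle_le {τ : ℝ} (hτ : 0 < τ) (hτ1 : τ ≤ 1) {θ : ℝ}
    (hθ : θ ∈ Set.Icc (-Real.pi) Real.pi) :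
    (fB (τ * Complex.exp (θ * Complex.I))).re - rB τ ≤
      -(τ ^ 3 * (3 / 2) / Real.pi ^ 2) * θ ^ 2 := by
  set z : ℂ := τ * Complex.exp (θ * Complex.I) with hz
  have hn : ‖z‖ = τ := by
    rw [hz, norm_mul, Complex.norm_exp_ofReal_mul_I, mul_one, Complex.norm_real,
      Real.norm_of_nonneg hτ.le]
  have h1 := (Complex.re_le_norm _).trans (norm_fB_sub_le z)
  have hpow : ∀ m : ℕ, (z ^ m).re = τ ^ m * Real.cos (m * θ) := fun m => by
    rw [hz, mul_pow, ← Complex.exp_nat_mul, ← mul_assoc, ← Complex.ofReal_pow,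
      ← Complex.ofReal_natCast, ← Complex.ofReal_mul, Complex.re_ofReal_mul,
      Complex.exp_ofReal_mul_I_re]
  rw [hn, Complex.sub_re, Complex.sub_re, hpow, hpow] at h1
  push_cast at h1
  rw [Real.cos_two_mul, Real.cos_three_mul] at h1
  have h2 := Real.cos_le_one_sub_mul_cos_sq (x := θ) (abs_le.2 hθ)
  have h3 := Real.neg_one_le_cos θ
  set x := Real.cos θ
  have h4 : 2 / Real.pi ^ 2 * θ ^ 2 ≤ 1 - x := by linarith
  have hx : 0 ≤ 1 - x := by
    have := Real.cos_le_one θ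
    linarith
  have h5 : τ ^ 3 * ((1 - x) * (2 * (1 + x))) ≤ τ ^ 2 * ((1 - x) * (2 * (1 + x))) :=
    mul_le_mul_of_nonneg_right (pow_le_pow_of_le_one hτ.le hτ1 (by norm_num))
      (mul_nonneg hx (by linarith))
  have h6 : τ ^ 3 * ((1 - x) * (3 / 4)) ≤ τ ^ 3 * ((1 - x) * (4 * x ^ 2 + 6 * x + 3)) := by
    gcongr
    nlinarith [sq_nonneg (2 * x + 3 / 2)]
  have h7 : τ ^ 3 * (2 / Real.pi ^ 2 * θ ^ 2 * (3 / 4)) ≤ τ ^ 3 * ((1 - x) * (3 / 4)) := by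
    gcongr
  have h8 : τ ^ 3 * (2 / Real.pi ^ 2 * θ ^ 2 * (3 / 4)) =
      τ ^ 3 * (3 / 2) / Real.pi ^ 2 * θ ^ 2 := by ring
  linarith

theorem differentiable_dslope {k : ℂ → ℂ} (hk : Differentiable ℂ k) (a : ℂ) :
    Differentiable ℂ (dslope k a) := by
  rw [← differentiableOn_univ] at *
  exact (Complex.differentiableOn_dslope univ_mem).2 hk

theorem exists_phase {τ : ℝ} (hτ : (τ : ℂ) * fB' τ = 1) : ∃ e : ℝ → ℂ, Continuous e ∧
    ∀ θ : ℝ, fB (τ * Complex.exp (θ * Complex.I)) - rB τ - θ * Complex.I = -e θ * θ ^ 2 := by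
  let k : ℂ → ℂ := fun s => fB (τ * Complex.exp s) - rB τ - s
  have hkd : ∀ s, HasDerivAt k (fB' (τ * Complex.exp s) * (τ * Complex.exp s) - 1) s := fun s =>
    (((hasDerivAt_fB _).comp s ((Complex.hasDerivAt_exp s).const_mul (τ : ℂ))).sub_const _).sub
      (hasDerivAt_id s)
  have hk : Differentiable ℂ k := fun s => (hkd s).differentiableAt
  have hk0 : k 0 = 0 := by simp [k, fB_ofReal]
  have hk1 : deriv k 0 = 0 := by
    rw [(hkd 0).deriv]
    simp only [Complex.exp_zero, mul_one]
    rw [mul_comm, hτ, sub_self]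
  have hd := differentiable_dslope (differentiable_dslope hk 0) 0
  refine ⟨fun θ => dslope (dslope k 0) 0 (θ * Complex.I), hd.continuous.comp (by fun_prop), ?_⟩
  intro θ
  have h1 := sub_smul_dslope k 0 (θ * Complex.I)
  have h2 := sub_smul_dslope (dslope k 0) 0 (θ * Complex.I)
  rw [dslope_same, hk1] at h2
  rw [hk0] at h1
  simp only [sub_zero, smul_eq_mul] at h1 h2
  change k (θ * Complex.I) = _
  rw [← h1, ← h2]
  linear_combination θ ^ 2 * dslope (dslope k 0) 0 (θ * Complex.I) * Complex.I_sq

theorem fG'_saddle_ne_zero {τ : ℝ} (hτ0 : 0 < τ) (hτ : (τ : ℂ) * fB' τ = 1) : fG' τ ≠ 0 := by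
  have hτ' : (τ : ℂ) ≠ 0 := by exact_mod_cast hτ0.ne'
  have hB : fB' τ = ((τ⁻¹ : ℝ) : ℂ) := by
    push_cast
    field_simp
    rw [mul_comm, hτ]
  have hA : fA' τ = ((Real.exp τ * (1 + τ) : ℝ) : ℂ) := by
    simp [fA']
  have hpos : 0 < Real.exp τ * (1 + τ) + τ⁻¹ := by positivity
  rw [fG', fH', hτ, sub_self, mul_zero, mul_zero, add_zero, hA, hB, ← Complex.ofReal_add]
  exact mul_ne_zero (by exact_mod_cast hpos.ne') (Complex.exp_ne_zero _)

theorem sq_mul_iN_mul_pow {τ : ℝ} (hτ0 : 0 < τ) (n : ℕ) :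
    (n : ℂ) ^ 2 * (iN n / n.factorial) * (τ * Complex.exp (-rB τ)) ^ n =
      τ / (2 * Real.pi) * ∫ θ in (-Real.pi)..Real.pi,
        fG' (τ * Complex.exp (θ * Complex.I)) * Complex.exp (θ * Complex.I) *
          Complex.exp (n * (fB (τ * Complex.exp (θ * Complex.I)) - rB τ - θ * Complex.I)) := by
  have h := sq_mul_iN_eq_circleIntegral hτ0 n
  have hper : Function.Periodic
      (fun θ : ℝ => deriv (circleMap 0 τ) θ • (fG' (circleMap 0 τ θ) / fh (circleMap 0 τ θ) ^ n))
      (2 * Real.pi) := fun θ => by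
    simp only [deriv_circleMap, periodic_circleMap 0 τ θ]
  have hint := hper.intervalIntegral_add_eq 0 (-Real.pi)
  rw [zero_add, show -Real.pi + 2 * Real.pi = Real.pi by ring] at hint
  rw [circleIntegral, hint] at h
  have hτ' : (τ : ℂ) ≠ 0 := by exact_mod_cast hτ0.ne'
  have hpi : (Real.pi : ℂ) ≠ 0 := by exact_mod_cast Real.pi_ne_zero
  have e : (2 * Real.pi * Complex.I) * ((n : ℂ) ^ 2 * (iN n / n.factorial) *
      (τ * Complex.exp (-rB τ)) ^ n) = ∫ θ in (-Real.pi)..Real.pi, (τ * Complex.I) *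
        (fG' (τ * Complex.exp (θ * Complex.I)) * Complex.exp (θ * Complex.I) *
          Complex.exp (n * (fB (τ * Complex.exp (θ * Complex.I)) - rB τ - θ * Complex.I))) := by
    calc _ = (n : ℂ) ^ 2 * (2 * Real.pi * Complex.I * (iN n / n.factorial)) *
          (τ * Complex.exp (-rB τ)) ^ n := by ring
      _ = _ := by
        rw [h, ← intervalIntegral.integral_mul_const]
        refine intervalIntegral.integral_congr fun θ _ => ?_
        simp only [deriv_circleMap, circleMap, zero_add, smul_eq_mul, fh]
        set z : ℂ := τ * Complex.exp (θ * Complex.I)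
        have e1 : Complex.exp (n * (fB z - rB τ - θ * Complex.I)) =
            Complex.exp (-rB τ) ^ n / (Complex.exp (-fB z) * Complex.exp (θ * Complex.I)) ^ n := by
          rw [← Complex.exp_add, ← Complex.exp_nat_mul, ← Complex.exp_nat_mul, ← Complex.exp_sub]
          ring_nf
        have hz : z = τ * Complex.exp (θ * Complex.I) := rfl
        rw [e1]
        nth_rewrite 1 3 [hz]
        simp only [mul_pow]
        have := Complex.exp_ne_zero (θ * Complex.I)
        have := Complex.exp_ne_zero (-fB z)
        field_simp
  rw [intervalIntegral.integral_const_mul] at e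
  have hI := Complex.I_ne_zero
  refine mul_left_cancel₀ (mul_ne_zero (mul_ne_zero two_ne_zero hpi) hI) (e.trans ?_)
  field_simp

end SaddlePoint

theorem tendsto_complex_iN {τ : ℝ} (hτ0 : 0 < τ) (hτ1 : τ ≤ 1) (hτ : (τ : ℂ) * fB' τ = 1) :
    ∃ L : ℂ, L ≠ 0 ∧ Tendsto (fun n : ℕ => (Real.sqrt n : ℂ) *
      ((n : ℂ) ^ 2 * (iN n / n.factorial) * (τ * Complex.exp (-rB τ)) ^ n)) atTop (𝓝 L) := by
  obtain ⟨e, he, hφe⟩ := exists_phase hτ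
  set c : ℝ := τ ^ 3 * (3 / 2) / Real.pi ^ 2 with hc
  have hc0 : 0 < c := by positivity
  let φ : ℝ → ℂ := fun θ => fB (τ * Complex.exp (θ * Complex.I)) - rB τ - θ * Complex.I
  have hle : ∀ θ ∈ Set.Icc (-Real.pi) Real.pi, (φ θ).re ≤ -c * θ ^ 2 := fun θ hθ => by
    simpa [φ] using re_fB_circle_le hτ0 hτ1 hθ
  have hd : 0 < (e 0).re := by
    refine hc0.trans_le (ge_of_tendsto (((Complex.continuous_re.comp he).tendsto 0).mono_left
      (nhdsWithin_le_nhds (s := Set.Ioi 0))) ?_)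
    filter_upwards [Ioc_mem_nhdsGT Real.pi_pos] with θ hθ
    have h1 := hle θ ⟨by linarith [hθ.1, Real.pi_pos], hθ.2⟩
    have h2 : (φ θ).re = -(e θ).re * θ ^ 2 := by
      simp only [φ, hφe]
      rw [← Complex.ofReal_pow, Complex.re_mul_ofReal, Complex.neg_re]
    rw [h2] at h1
    have h3 : 0 < θ ^ 2 := pow_pos hθ.1 2
    exact le_of_mul_le_mul_right (by simp only [Function.comp_apply]; linarith) h3
  have hG : Continuous fG' := (differentiable_of_hasDerivAt hasDerivAt_fG).continuous
  have hB : Continuous fB := differentiable_fB.continuous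
  have key := tendsto_sqrt_mul_integral_exp (φ := φ) (c := c)
    (K := fun θ => fG' (τ * Complex.exp (θ * Complex.I)) * Complex.exp (θ * Complex.I))
    (by fun_prop) (by fun_prop) hc0 hle he rfl hφe hd
  have hpi : (Real.pi : ℂ) ≠ 0 := by exact_mod_cast Real.pi_ne_zero
  have hτ' : (τ : ℂ) ≠ 0 := by exact_mod_cast hτ0.ne'
  have he0 : e 0 ≠ 0 := fun h => by simp [h] at hd
  refine ⟨_, ?_, (key.const_mul (τ / (2 * Real.pi) : ℂ)).congr fun n => ?_⟩
  · simpa [Complex.cpow_eq_zero_iff, hpi, hτ', he0] using fG'_saddle_ne_zero hτ0 hτ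
  · rw [sq_mul_iN_mul_pow hτ0]
    ring

theorem exists_pos_tendsto_of_complex {a : ℕ → ℝ} (ha : ∀ n, 0 ≤ a n) {L : ℂ} (hL : L ≠ 0)
    (h : Tendsto (fun n => (a n : ℂ)) atTop (𝓝 L)) : ∃ A, 0 < A ∧ Tendsto a atTop (𝓝 A) := by
  have hre : Tendsto a atTop (𝓝 L.re) := (Complex.continuous_re.tendsto L).comp h
  have him : L.im = 0 := tendsto_nhds_unique ((Complex.continuous_im.tendsto L).comp h)
    (by simp [Function.comp_def])
  refine ⟨L.re, lt_of_le_of_ne (ge_of_tendsto' hre ha) fun h0 => hL ?_, hre⟩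
  exact Complex.ext h0.symm him

end ForestMIS

theorem stmt_4 :
    ∃ A ρ₁ : ℝ, 0 < A ∧ 0 < ρ₁ ∧ ρ₁ < Real.exp (-1) ∧
      Tendsto
        (fun n : ℕ =>
          (iN n : ℝ) * ρ₁ ^ n * (n : ℝ) ^ ((5 : ℝ) / 2) / (Nat.factorial n : ℝ))
        atTop (nhds A) := by
  obtain ⟨τ, hτ0, hτ1, hτ⟩ := ForestMIS.exists_saddle
  obtain ⟨L, hL, h⟩ := ForestMIS.tendsto_complex_iN hτ0 hτ1 hτ
  have hρ : 0 < τ * Real.exp (-ForestMIS.rB τ) := by positivity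
  obtain ⟨A, hA, hlim⟩ := ForestMIS.exists_pos_tendsto_of_complex (a := fun n : ℕ =>
    (iN n : ℝ) * (τ * Real.exp (-ForestMIS.rB τ)) ^ n * (n : ℝ) ^ ((5 : ℝ) / 2) / (Nat.factorial n : ℝ))
    (fun n => by positivity) hL (h.congr fun n => by
      have e : (n : ℝ) ^ ((5 : ℝ) / 2) = Real.sqrt n * (n : ℝ) ^ 2 := by
        rw [Real.sqrt_eq_rpow, ← Real.rpow_natCast, ← Real.rpow_add_of_nonneg] <;> norm_num
      rw [e]
      push_cast
      ring)
  exact ⟨A, _, hA, hρ, ForestMIS.mul_exp_neg_rB_lt hτ0, hlim⟩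
end

section
/- For each n ≥ 1 let m_n denote the number of pairs (F, M) where F is an acyclic simple graph (forest) on the vertex set Fin n and M is a maximal matching of F. Then there exist real constants A₂ > 0 and ρ₂ with 0 < ρ₂ < e^{-1} such that the sequence m_n · ρ₂^n · n^{5/2} / n! converges to A₂ as n → ∞. -/
open Filter Topology MeasureTheory

/-- `M` is a matching of `G`: a set of edges of `G`, no two distinct
edges of which share a vertex. -/
def IsMatching {V : Type*} (G : SimpleGraph V) (M : Set (Sym2 V)) : Prop :=
  M ⊆ G.edgeSet ∧ ∀ e ∈ M, ∀ f ∈ M, e ≠ f → ∀ v : V, v ∈ e → v ∉ f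

/-- `M` is a maximal matching of `G`. -/
def IsMaximalMatching {V : Type*} (G : SimpleGraph V) (M : Set (Sym2 V)) : Prop :=
  IsMatching G M ∧ ∀ M' : Set (Sym2 V), IsMatching G M' → ¬ M ⊂ M'

/-- The pairs `(F, M)` where `F` is a forest (acyclic simple graph) on `Fin n`
and `M` is a maximal matching of `F`. -/
def MMSpace (n : ℕ) :=
  {p : SimpleGraph (Fin n) × Set (Sym2 (Fin n)) // p.1.IsAcyclic ∧ IsMaximalMatching p.1 p.2}

/-- `mN n` is the number of pairs `(F, M)` where `F` is a forest on `Fin n`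
and `M` is a maximal matching of `F`. -/
noncomputable def mN (n : ℕ) : ℕ := Nat.card (MMSpace n)

namespace SimpleGraph

variable {α : Type*}

/-- No two distinct vertices of `R` lie in the same component of `G`. -/
def Separated (G : SimpleGraph α) (R : Set α) : Prop :=
  ∀ x ∈ R, ∀ y ∈ R, G.Reachable x y → x = y

/-- The star with centre `v` and set of leaves `U` (without `v`). -/
def starOn (v : α) (U : Set α) : SimpleGraph α :=
  fromRel fun a b => a = v ∧ b ∈ U

lemma starOn_adj {v : α} {U : Set α} {a b : α} :
    (starOn v U).Adj a b ↔ a ≠ b ∧ (a = v ∧ b ∈ U ∨ b = v ∧ a ∈ U) := by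
  simp [starOn]

lemma starOn_insert (v w : α) (U : Set α) :
    starOn v (insert w U) = starOn v U ⊔ edge v w := by
  ext a b
  simp only [starOn_adj, sup_adj, edge_adj, Set.mem_insert_iff]
  tauto

lemma reachable_of_reachable_sup_edge {G : SimpleGraph α} {v w x y : α}
    (h : (G ⊔ edge v w).Reachable x y) :
    G.Reachable x y ∨ (G.Reachable x v ∧ G.Reachable w y) ∨
      (G.Reachable x w ∧ G.Reachable v y) := by
  obtain ⟨p⟩ := h
  induction p with
  | nil => exact .inl .rfl
  | @cons a b c hab p ih =>
    rw [sup_adj, edge_adj] at hab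
    rcases hab with hab | ⟨⟨rfl, rfl⟩ | ⟨rfl, rfl⟩, -⟩
    · have hr := hab.reachable
      rcases ih with h | ⟨h, h'⟩ | ⟨h, h'⟩
      · exact .inl (hr.trans h)
      · exact .inr (.inl ⟨hr.trans h, h'⟩)
      · exact .inr (.inr ⟨hr.trans h, h'⟩)
    · rcases ih with h | ⟨h, h'⟩ | ⟨h, h'⟩
      · exact .inr (.inl ⟨.rfl, h⟩)
      · exact .inr (.inl ⟨.rfl, h'⟩)
      · exact .inl h'
    · rcases ih with h | ⟨h, h'⟩ | ⟨h, h'⟩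
      · exact .inr (.inr ⟨.rfl, h⟩)
      · exact .inl h'
      · exact .inr (.inr ⟨.rfl, h'⟩)

lemma isAcyclic_separated_sup_edge_iff {G : SimpleGraph α} {R : Set α} {v w : α}
    (hv : v ∈ R) (hw : w ∉ R) (hvw : ¬ G.Adj v w) :
    (G ⊔ edge v w).IsAcyclic ∧ (G ⊔ edge v w).Separated R ↔
      G.IsAcyclic ∧ G.Separated (insert w R) := by
  have hne : v ≠ w := fun h => hw (h ▸ hv)
  have hadj : (G ⊔ edge v w).Adj v w := by simp [edge_adj, hne]
  rw [isAcyclic_sup_fromEdgeSet_iff]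
  constructor
  · rintro ⟨⟨hG, hr⟩, hsep⟩
    have hr' : ¬ G.Reachable v w := fun h => (hr h).elim hne hvw
    have key : ∀ y ∈ R, ¬ G.Reachable w y := by
      intro y hy h
      have := hsep v hv y hy (hadj.reachable.trans (h.mono le_sup_left))
      subst this
      exact hr' h.symm
    refine ⟨hG, ?_⟩
    rintro x (rfl | hx) y (rfl | hy) h
    · rfl
    · exact (key y hy h).elim
    · exact (key x hx h.symm).elim
    · exact hsep x hx y hy (h.mono le_sup_left)
  · rintro ⟨hG, hsep⟩
    have hvr : v ∈ insert w R := .inr hv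
    have hwr : w ∈ insert w R := .inl rfl
    refine ⟨⟨hG, fun h => .inl (hsep v hvr w hwr h)⟩, ?_⟩
    intro x hx y hy h
    rcases reachable_of_reachable_sup_edge h with h | ⟨-, h⟩ | ⟨h, -⟩
    · exact hsep x (.inr hx) y (.inr hy) h
    · exact (hw ((hsep w hwr y (.inr hy) h) ▸ hy)).elim
    · exact (hw ((hsep x (.inr hx) w hwr h) ▸ hx)).elim

lemma isAcyclic_separated_sup_starOn_iff {G : SimpleGraph α} {v : α} {U : Set α}
    (hU : U.Finite) (hG : ∀ w, ¬ G.Adj v w) :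
    ∀ {R : Set α}, v ∈ R → Disjoint U R →
    ((G ⊔ starOn v U).IsAcyclic ∧ (G ⊔ starOn v U).Separated R ↔
      G.IsAcyclic ∧ G.Separated (R ∪ U)) := by
  induction U, hU using Set.Finite.induction_on with
  | empty =>
    intro R _ _
    have : starOn v (∅ : Set α) = ⊥ := by ext; simp [starOn_adj]
    simp [this]
  | @insert w U hwU _ ih =>
    intro R hv hd
    rw [Set.disjoint_insert_left] at hd
    rw [starOn_insert, ← sup_assoc, isAcyclic_separated_sup_edge_iff hv hd.1, ih (.inr hv),
      Set.insert_union, Set.union_insert]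
    · exact Set.disjoint_insert_right.2 ⟨hwU, hd.2⟩
    · simp only [sup_adj, starOn_adj, hG, false_or, not_and, not_or]
      rintro - 
      grind

lemma Separated.mono {G : SimpleGraph α} {R R' : Set α} (h : G.Separated R) (hR : R' ⊆ R) :
    G.Separated R' := fun x hx y hy => h x (hR hx) y (hR hy)

lemma separated_insert_iff_of_isolated {G : SimpleGraph α} {v : α} {R : Set α}
    (hG : ∀ w, ¬ G.Adj v w) : G.Separated (insert v R) ↔ G.Separated R := by
  have key : ∀ y, G.Reachable v y → v = y := by
    rintro y ⟨p⟩
    cases p with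
    | nil => rfl
    | cons h _ => exact (hG _ h).elim
  refine ⟨fun h => h.mono (Set.subset_insert _ _), ?_⟩
  rintro h x (rfl | hx) y (rfl | hy) hr
  · rfl
  · exact key _ hr
  · exact (key _ hr.symm).symm
  · exact h x hx y hy hr

lemma isAcyclic_separated_delete_iff {G : SimpleGraph α} {v : α} {U R : Set α}
    (hU : U.Finite) (hG : ∀ w, ¬ G.Adj v w) (hv : v ∉ U) (hd : Disjoint U R) :
    (G ⊔ starOn v U).IsAcyclic ∧ (G ⊔ starOn v U).Separated (insert v R) ↔
      G.IsAcyclic ∧ G.Separated (R ∪ U) := by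
  rw [isAcyclic_separated_sup_starOn_iff hU hG (.inl rfl) (Set.disjoint_insert_right.2 ⟨hv, hd⟩),
    Set.insert_union, separated_insert_iff_of_isolated hG]

variable [DecidableEq α]

/-- `G` is a forest on `N ∪ Y ∪ B ∪ W` with at most one of the roots `Y ∪ B ∪ W` in each component,
and `M` is a matching of `G`; the roots in `B` are matched, those in `W` are unmatched, and every
edge of `G` avoiding `W` has a matched endpoint. -/
structure RootedMatching (N Y B W : Finset α) (G M : SimpleGraph α) : Prop where
  forest : G.IsAcyclic ∧ G.Separated ((Y ∪ B ∪ W : Finset α) : Set α)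
  mem_of_adj : ∀ a b, G.Adj a b → a ∈ N ∨ a ∈ Y ∨ a ∈ B ∨ a ∈ W
  le : ∀ a b, M.Adj a b → G.Adj a b
  unique : ∀ a b c, M.Adj a b → M.Adj a c → b = c
  matched : ∀ a ∈ B, ∃ b, M.Adj a b
  unmatched : ∀ a ∈ W, ∀ b, ¬ M.Adj a b
  maximal : ∀ a b, G.Adj a b → a ∉ W → b ∉ W → (∃ c, M.Adj a c) ∨ ∃ c, M.Adj b c

/-- The four sets are pairwise disjoint. -/
structure Disj4 (N Y B W : Finset α) : Prop where
  ny : Disjoint N Y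
  nb : Disjoint N B
  nw : Disjoint N W
  yb : Disjoint Y B
  yw : Disjoint Y W
  bw : Disjoint B W

lemma RootedMatching.adj_root {N Y B W : Finset α} {G M : SimpleGraph α}
    (h : RootedMatching N Y B W G M) {v w : α} (hv : v ∈ Y ∪ B ∪ W) (hvw : G.Adj v w) :
    w ∈ N := by
  have h1 := h.mem_of_adj w v hvw.symm
  have h2 : w ∉ Y ∪ B ∪ W := fun hw =>
    hvw.ne (h.forest.2 v (by exact_mod_cast hv) w (by exact_mod_cast hw) hvw.reachable)
  grind

lemma rootedMatching_delete_unmatched_iff {N Y B W U : Finset α} {v : α} {G M : SimpleGraph α}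
    (hd : Disj4 N Y B (insert v W)) (_hvW : v ∉ W) (hU : U ⊆ N) (hG : ∀ w, ¬ G.Adj v w) :
    RootedMatching N Y B (insert v W) (G ⊔ starOn v U) M ↔
      RootedMatching (N \ U) (Y ∪ U) B W G M := by
  obtain ⟨h1, h2, h3, h4, h5, h6⟩ := hd
  simp only [Finset.disjoint_left, Finset.mem_insert] at h1 h2 h3 h4 h5 h6
  have hvU : v ∉ U := fun h => h3 (hU h) (.inl rfl)
  have key := isAcyclic_separated_delete_iff (R := ((Y ∪ B ∪ W : Finset α) : Set α))
    U.finite_toSet hG (by simpa using hvU)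
    (by rw [Finset.disjoint_coe, Finset.disjoint_left]; grind)
  have e1 : ((Y ∪ B ∪ insert v W : Finset α) : Set α) =
    insert v ((Y ∪ B ∪ W : Finset α) : Set α) := by ext; simp
  have e2 : ((Y ∪ U ∪ B ∪ W : Finset α) : Set α) =
    ((Y ∪ B ∪ W : Finset α) : Set α) ∪ U := by ext; simp; tauto
  have hs : ∀ a b, (G ⊔ starOn v U).Adj a b ↔ G.Adj a b ∨
      (a ≠ b ∧ (a = v ∧ b ∈ U ∨ b = v ∧ a ∈ U)) := by
    intro a b; simp [starOn_adj]
  have hG' : ∀ w, ¬ G.Adj w v := fun w h => hG w h.symm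
  constructor
  · rintro ⟨k1, k2, k3, k4, k5, k6, k7⟩
    rw [e1, key, ← e2] at k1
    simp only [hs] at k2 k3 k7
    refine ⟨k1, ?_, ?_, k4, k5, ?_, ?_⟩
    · grind
    · intro a b hab
      have := k6 v (by simp)
      have h' := hab.symm
      grind
    · grind
    · grind
  · rintro ⟨k1, k2, k3, k4, k5, k6, k7⟩
    rw [e2, ← key, ← e1] at k1
    refine ⟨k1, ?_, ?_, k4, k5, ?_, ?_⟩ <;> try simp only [hs]
    · grind
    · grind
    · grind
    · grind

lemma rootedMatching_delete_free_iff {N Y B W U : Finset α} {v : α} {G M : SimpleGraph α}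
    (hd : Disj4 N (insert v Y) B W) (hvY : v ∉ Y) (hU : U ⊆ N) (hG : ∀ w, ¬ G.Adj v w) :
    (RootedMatching N (insert v Y) B W (G ⊔ starOn v U) M ∧ ∀ w, ¬ M.Adj v w) ↔
      RootedMatching (N \ U) Y (B ∪ U) W G M := by
  obtain ⟨h1, h2, h3, h4, h5, h6⟩ := hd
  simp only [Finset.disjoint_left, Finset.mem_insert] at h1 h2 h3 h4 h5 h6
  have hvU : v ∉ U := fun h => h1 (hU h) (.inl rfl)
  have key := isAcyclic_separated_delete_iff (R := ((Y ∪ B ∪ W : Finset α) : Set α))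
    U.finite_toSet hG (by simpa using hvU)
    (by rw [Finset.disjoint_coe, Finset.disjoint_left]; grind)
  have e1 : ((insert v Y ∪ B ∪ W : Finset α) : Set α) =
    insert v ((Y ∪ B ∪ W : Finset α) : Set α) := by ext; simp
  have e2 : ((Y ∪ (B ∪ U) ∪ W : Finset α) : Set α) =
    ((Y ∪ B ∪ W : Finset α) : Set α) ∪ U := by ext; simp; tauto
  have hs : ∀ a b, (G ⊔ starOn v U).Adj a b ↔ G.Adj a b ∨
      (a ≠ b ∧ (a = v ∧ b ∈ U ∨ b = v ∧ a ∈ U)) := by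
    intro a b; simp [starOn_adj]
  have hG' : ∀ w, ¬ G.Adj w v := fun w h => hG w h.symm
  constructor
  · rintro ⟨⟨k1, k2, k3, k4, k5, k6, k7⟩, k8⟩
    rw [e1, key, ← e2] at k1
    simp only [hs] at k2 k3 k7
    refine ⟨k1, ?_, ?_, k4, ?_, ?_, ?_⟩
    · grind
    · intro a b hab
      have h' := hab.symm
      grind
    · intro a ha
      have := k7 v a
      grind
    · grind
    · grind
  · rintro ⟨k1, k2, k3, k4, k5, k6, k7⟩
    rw [e2, ← key, ← e1] at k1
    refine ⟨⟨k1, ?_, ?_, k4, ?_, ?_, ?_⟩, ?_⟩ <;> try simp only [hs]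
    · grind
    · grind
    · exact fun a ha => k5 a (Finset.mem_union_left _ ha)
    · grind
    · grind
    · grind

lemma rootedMatching_delete_edge_iff {N Y B W : Finset α} {v w : α} {G M : SimpleGraph α}
    (hd : Disj4 N Y (insert v B) W) (hvB : v ∉ B) (hw : w ∈ N) (hG : ¬ G.Adj v w) :
    (RootedMatching N Y (insert v B) W (G ⊔ edge v w) (M ⊔ edge v w) ∧ ¬ M.Adj v w) ↔
      RootedMatching (N.erase w) Y B (insert v (insert w W)) G M := by
  obtain ⟨h1, h2, h3, h4, h5, h6⟩ := hd
  simp only [Finset.disjoint_left, Finset.mem_insert] at h1 h2 h3 h4 h5 h6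
  have hne : v ≠ w := by grind
  have key := isAcyclic_separated_sup_edge_iff (R := ((Y ∪ insert v B ∪ W : Finset α) : Set α))
    (v := v) (w := w) (by simp) (by simp; grind) hG
  have e2 : ((Y ∪ B ∪ insert v (insert w W) : Finset α) : Set α) =
    insert w ((Y ∪ insert v B ∪ W : Finset α) : Set α) := by ext; simp; tauto
  have hs : ∀ (G : SimpleGraph α) a b, (G ⊔ edge v w).Adj a b ↔ G.Adj a b ∨
      ((a = v ∧ b = w ∨ a = w ∧ b = v) ∧ a ≠ b) := by
    intro G a b; simp [edge_adj]
  have hG' : ¬ G.Adj w v := fun h => hG h.symm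
  constructor
  · rintro ⟨⟨k1, k2, k3, k4, k5, k6, k7⟩, k8⟩
    rw [key, ← e2] at k1
    simp only [hs] at k2 k3 k4 k5 k6 k7
    have k8' : ¬ M.Adj w v := fun h => k8 h.symm
    clear key e2 hs
    refine ⟨k1, ?_, ?_, ?_, ?_, ?_, ?_⟩
    · intro a b hab
      have := k2 a b (.inl hab)
      simp only [Finset.mem_insert, Finset.mem_erase] at this ⊢
      tauto
    · intro a b hab
      rcases k3 a b (.inl hab) with h | ⟨⟨rfl, rfl⟩ | ⟨rfl, rfl⟩, -⟩
      · exact h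
      · exact (k8 hab).elim
      · exact (k8' hab).elim
    · exact fun a b c hb hc => k4 a b c (.inl hb) (.inl hc)
    · intro a ha
      obtain ⟨b, hb⟩ := k5 a (Finset.mem_insert_of_mem ha)
      refine ⟨b, hb.resolve_right ?_⟩
      rintro ⟨⟨rfl, -⟩ | ⟨rfl, -⟩, -⟩
      · exact hvB ha
      · exact h2 hw (.inr ha)
    · intro a ha b hab
      simp only [Finset.mem_insert] at ha
      rcases ha with rfl | rfl | ha
      · have := k4 a b w (.inl hab) (.inr ⟨.inl ⟨rfl, rfl⟩, hne⟩)
        exact k8 (this ▸ hab)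
      · have := k4 a b v (.inl hab) (.inr ⟨.inr ⟨rfl, rfl⟩, hne.symm⟩)
        exact k8' (this ▸ hab)
      · exact k6 a ha b (.inl hab)
    · intro a b hab ha hb
      simp only [Finset.mem_insert, not_or] at ha hb
      rcases k7 a b (.inl hab) ha.2.2 hb.2.2 with ⟨c, hc⟩ | ⟨c, hc⟩
      · exact .inl ⟨c, by tauto⟩
      · exact .inr ⟨c, by tauto⟩
  · rintro ⟨k1, k2, k3, k4, k5, k6, k7⟩
    rw [e2, ← key] at k1
    have kv : ∀ b, ¬ M.Adj v b := k6 v (by simp)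
    have kw : ∀ b, ¬ M.Adj w b := k6 w (by simp)
    refine ⟨⟨k1, ?_, ?_, ?_, ?_, ?_, ?_⟩, kv w⟩ <;> simp only [hs] <;> clear key e2 hs
    · rintro a b (hab | ⟨⟨rfl, rfl⟩ | ⟨rfl, rfl⟩, -⟩)
      · have := k2 a b hab
        simp only [Finset.mem_insert, Finset.mem_erase] at this ⊢
        rcases this with h | h | h | rfl | rfl | h <;> tauto
      · simp
      · exact .inl hw
    · exact fun a b => Or.imp_left (k3 a b)
    · rintro a b c (hb | ⟨⟨rfl, rfl⟩ | ⟨rfl, rfl⟩, -⟩) (hc | ⟨⟨h, rfl⟩ | ⟨h, rfl⟩, -⟩)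
      · exact k4 a b c hb hc
      · exact (kv _ (h ▸ hb)).elim
      · exact (kw _ (h ▸ hb)).elim
      · exact (kv _ hc).elim
      · rfl
      · exact (hne h).elim
      · exact (kw _ hc).elim
      · exact (hne h.symm).elim
      · rfl
    · intro a ha
      rcases Finset.mem_insert.1 ha with rfl | ha
      · exact ⟨w, .inr ⟨.inl ⟨rfl, rfl⟩, hne⟩⟩
      · obtain ⟨b, hb⟩ := k5 a ha
        exact ⟨b, .inl hb⟩
    · rintro a ha b (hab | ⟨⟨rfl, rfl⟩ | ⟨rfl, rfl⟩, -⟩)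
      · exact k6 a (by simp [ha]) b hab
      · exact h6 (.inl rfl) ha
      · exact h3 hw ha
    · intro a b hab ha hb
      by_cases hav : a = v
      · exact .inl ⟨w, .inr ⟨.inl ⟨hav, rfl⟩, hav ▸ hne⟩⟩
      by_cases haw : a = w
      · exact .inl ⟨v, .inr ⟨.inr ⟨haw, rfl⟩, hav⟩⟩
      by_cases hbv : b = v
      · exact .inr ⟨w, .inr ⟨.inl ⟨hbv, rfl⟩, hbv ▸ hne⟩⟩
      by_cases hbw : b = w
      · exact .inr ⟨v, .inr ⟨.inr ⟨hbw, rfl⟩, hbv⟩⟩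
      have hab' : G.Adj a b := by tauto
      exact (k7 a b hab' (by simp [*]) (by simp [*])).imp
        (fun ⟨c, hc⟩ => ⟨c, .inl hc⟩) (fun ⟨c, hc⟩ => ⟨c, .inl hc⟩)

section Counting

variable [Fintype α]

open scoped Classical in
/-- The set of pairs `(G, M)` with the property `P`. -/
noncomputable def pairs (P : SimpleGraph α → SimpleGraph α → Prop) :
    Finset (SimpleGraph α × SimpleGraph α) :=
  (Set.toFinite {p : SimpleGraph α × SimpleGraph α | P p.1 p.2}).toFinset

omit [DecidableEq α] in
lemma mem_pairs {P : SimpleGraph α → SimpleGraph α → Prop} {p : SimpleGraph α × SimpleGraph α} :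
    p ∈ pairs P ↔ P p.1 p.2 := by
  simp [pairs]

omit [DecidableEq α] in
lemma pairs_congr {P Q : SimpleGraph α → SimpleGraph α → Prop} (h : ∀ G M, P G M ↔ Q G M) :
    pairs P = pairs Q := by
  ext p; simp only [mem_pairs, h]

lemma card_pairs_eq_sum_star {N : Finset α} {v : α} (hvN : v ∉ N)
    {P : SimpleGraph α → SimpleGraph α → Prop}
    {Q : Finset α → SimpleGraph α → SimpleGraph α → Prop}
    (hP : ∀ G M, P G M → ∀ w, G.Adj v w → w ∈ N)
    (hQ : ∀ U G M, U ⊆ N → Q U G M → ∀ w, ¬ G.Adj v w)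
    (h : ∀ U G M, U ⊆ N → (∀ w, ¬ G.Adj v w) → (P (G ⊔ starOn v U) M ↔ Q U G M)) :
    (pairs P).card = ∑ U ∈ N.powerset, (pairs (Q U)).card := by
  classical
  rw [Finset.card_eq_sum_card_fiberwise (f := fun p => N.filter (p.1.Adj v)) (t := N.powerset)
    (fun p _ => Finset.mem_coe.2 (Finset.mem_powerset.2 (Finset.filter_subset _ _)))]
  refine Finset.sum_congr rfl fun U hU => ?_
  rw [Finset.mem_powerset] at hU
  have hvU : v ∉ U := fun h => hvN (hU h)
  have hstar : ∀ p : SimpleGraph α × SimpleGraph α, P p.1 p.2 → N.filter (p.1.Adj v) = U →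
      p.1 \ starOn v U ⊔ starOn v U = p.1 ∧ ∀ w, ¬ (p.1 \ starOn v U).Adj v w := by
    intro p hp hpU
    have hm : ∀ w, w ∈ U ↔ p.1.Adj v w := by
      intro w
      rw [← hpU, Finset.mem_filter]
      exact ⟨fun h => h.2, fun h => ⟨hP _ _ hp w h, h⟩⟩
    refine ⟨sdiff_sup_cancel fun a b hab => ?_, fun w hw => ?_⟩
    · rw [starOn_adj] at hab
      rcases hab.2 with ⟨rfl, hb⟩ | ⟨rfl, hb⟩
      · exact (hm _).1 hb
      · exact ((hm _).1 hb).symm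
    · rw [sdiff_adj, starOn_adj] at hw
      exact hw.2 ⟨hw.1.ne, .inl ⟨rfl, (hm _).2 hw.1⟩⟩
  refine Finset.card_bij' (fun p _ => (p.1 \ starOn v U, p.2)) (fun p _ => (p.1 ⊔ starOn v U, p.2))
    ?_ ?_ ?_ ?_
  · intro p hp
    rw [Finset.mem_filter, mem_pairs] at hp
    obtain ⟨h1, h2⟩ := hstar p hp.1 hp.2
    rw [mem_pairs, ← h U _ _ hU h2, h1]
    exact hp.1
  · intro p hp
    rw [mem_pairs] at hp
    have hv := hQ _ _ _ hU hp
    rw [Finset.mem_filter, mem_pairs, h U _ _ hU hv]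
    refine ⟨hp, ?_⟩
    ext w
    simp only [Finset.mem_filter, sup_adj, hv, starOn_adj, false_or, true_and,
      Finset.mem_coe]
    constructor
    · rintro ⟨-, -, h | ⟨-, h⟩⟩
      · exact h
      · exact (hvU h).elim
    · exact fun h => ⟨hU h, fun h' => hvU (h' ▸ h), .inl h⟩
  · intro p hp
    rw [Finset.mem_filter, mem_pairs] at hp
    exact Prod.ext (hstar p hp.1 hp.2).1 rfl
  · intro p hp
    rw [mem_pairs] at hp
    have hv := hQ _ _ _ hU hp
    refine Prod.ext ?_ rfl
    ext a b
    simp only [sdiff_adj, sup_adj, starOn_adj]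
    constructor
    · tauto
    · refine fun hab => ⟨.inl hab, fun h => ?_⟩
      rcases h.2 with ⟨rfl, -⟩ | ⟨rfl, -⟩
      · exact hv _ hab
      · exact hv _ hab.symm

omit [Fintype α] in
lemma RootedMatching.isolated {N Y B W : Finset α} {G M : SimpleGraph α}
    (h : RootedMatching N Y B W G M) {v : α} (hN : v ∉ N) (hY : v ∉ Y) (hB : v ∉ B) (hW : v ∉ W)
    (w : α) : ¬ G.Adj v w := by
  intro hw
  rcases h.mem_of_adj v w hw with h | h | h | h <;> contradiction

lemma card_rootedMatching_insert_unmatched {N Y B W : Finset α} {v : α}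
    (hd : Disj4 N Y B (insert v W)) (hv : v ∉ W) :
    (pairs (RootedMatching N Y B (insert v W))).card =
      ∑ U ∈ N.powerset, (pairs (RootedMatching (N \ U) (Y ∪ U) B W)).card := by
  have hN := Finset.disjoint_right.1 hd.nw (Finset.mem_insert_self v W)
  have hY := Finset.disjoint_right.1 hd.yw (Finset.mem_insert_self v W)
  have hB := Finset.disjoint_right.1 hd.bw (Finset.mem_insert_self v W)
  refine card_pairs_eq_sum_star hN ?_ ?_ ?_
  · exact fun G M h w hw => h.adj_root (by simp) hw
  · exact fun U G M hU h => h.isolated (by simp [hN])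
      (by simpa [hY] using fun h => hN (hU h)) hB hv
  · exact fun U G M hU hG => rootedMatching_delete_unmatched_iff hd hv hU hG

lemma card_rootedMatching_insert_free {N Y B W : Finset α} {v : α}
    (hd : Disj4 N (insert v Y) B W) (hv : v ∉ Y) :
    (pairs (RootedMatching N (insert v Y) B W)).card =
      (pairs (RootedMatching N Y (insert v B) W)).card +
      ∑ U ∈ N.powerset, (pairs (RootedMatching (N \ U) Y (B ∪ U) W)).card := by
  classical
  have hN := Finset.disjoint_right.1 hd.ny (Finset.mem_insert_self v Y)
  have hB := Finset.disjoint_left.1 hd.yb (Finset.mem_insert_self v Y)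
  have hW := Finset.disjoint_left.1 hd.yw (Finset.mem_insert_self v Y)
  rw [← card_pairs_eq_sum_star (v := v) hN
    (P := fun G M => RootedMatching N (insert v Y) B W G M ∧ ∀ w, ¬ M.Adj v w)
    (fun G M h w hw => h.1.adj_root (by simp) hw)
    (fun U G M hU h => h.isolated (by simp [hN]) hv
      (by simpa [hB] using fun h => hN (hU h)) hW)
    (fun U G M hU hG => rootedMatching_delete_free_iff hd hv hU hG),
    ← Finset.card_filter_add_card_filter_not (s := pairs (RootedMatching N (insert v Y) B W))
      (fun p => ∃ w, p.2.Adj v w)]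
  congr 2
  · ext p
    rw [Finset.mem_filter, mem_pairs, mem_pairs]
    have e : Y ∪ insert v B ∪ W = insert v Y ∪ B ∪ W := by ext; simp
    constructor
    · rintro ⟨⟨k1, k2, k3, k4, k5, k6, k7⟩, k8⟩
      refine ⟨e ▸ k1, ?_, k3, k4, ?_, k6, k7⟩
      · intro a b hab
        have := k2 a b hab
        simp only [Finset.mem_insert] at this ⊢
        tauto
      · intro a ha
        rcases Finset.mem_insert.1 ha with rfl | ha
        · exact k8
        · exact k5 a ha
    · rintro ⟨k1, k2, k3, k4, k5, k6, k7⟩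
      refine ⟨⟨e ▸ k1, ?_, k3, k4, ?_, k6, k7⟩, k5 v (by simp)⟩
      · intro a b hab
        have := k2 a b hab
        simp only [Finset.mem_insert] at this ⊢
        tauto
      · exact fun a ha => k5 a (Finset.mem_insert_of_mem ha)
  · ext p
    simp [mem_pairs]

lemma card_rootedMatching_insert_matched {N Y B W : Finset α} {v : α}
    (hd : Disj4 N Y (insert v B) W) (hv : v ∉ B) :
    (pairs (RootedMatching N Y (insert v B) W)).card =
      ∑ w ∈ N, (pairs (RootedMatching (N.erase w) Y B (insert v (insert w W)))).card := by
  classical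
  have hN := Finset.disjoint_right.1 hd.nb (Finset.mem_insert_self v B)
  have hY := Finset.disjoint_right.1 hd.yb (Finset.mem_insert_self v B)
  have hW := Finset.disjoint_left.1 hd.bw (Finset.mem_insert_self v B)
  have hex : ∀ p ∈ pairs (RootedMatching N Y (insert v B) W), ∃ w, p.2.Adj v w :=
    fun p hp => (mem_pairs.1 hp).matched v (by simp)
  let f : SimpleGraph α × SimpleGraph α → α := fun p => if h : ∃ w, p.2.Adj v w then h.choose else v
  have hf : ∀ p ∈ pairs (RootedMatching N Y (insert v B) W), ∀ w, f p = w ↔ p.2.Adj v w := by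
    intro p hp w
    have hs := (hex p hp).choose_spec
    have hfp : f p = (hex p hp).choose := dif_pos (hex p hp)
    rw [hfp]
    exact ⟨fun h => h ▸ hs, fun h => (mem_pairs.1 hp).unique v _ _ hs h⟩
  rw [Finset.card_eq_sum_card_fiberwise (f := f) (t := N) (fun p hp => by
    have h1 := (hf p hp _).1 rfl
    exact (mem_pairs.1 hp).adj_root (by simp) ((mem_pairs.1 hp).le _ _ h1))]
  refine Finset.sum_congr rfl fun w hw => ?_
  have hne : v ≠ w := fun h => hN (h ▸ hw)
  have hle : ∀ p ∈ pairs (RootedMatching N Y (insert v B) W), f p = w →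
      p.1 \ edge v w ⊔ edge v w = p.1 ∧ p.2 \ edge v w ⊔ edge v w = p.2 := by
    intro p hp hpw
    have h1 := (hf p hp w).1 hpw
    have h2 := (mem_pairs.1 hp).le _ _ h1
    exact ⟨sdiff_sup_cancel ((edge_le_iff _).2 (.inr h2)),
      sdiff_sup_cancel ((edge_le_iff _).2 (.inr h1))⟩
  have hnot : ∀ p ∈ pairs (RootedMatching (N.erase w) Y B (insert v (insert w W))),
      ¬ p.1.Adj v w ∧ ¬ p.2.Adj v w := by
    intro p hp
    have h := mem_pairs.1 hp
    have h' : ¬ p.1.Adj v w := fun ha => by simpa using h.adj_root (by simp) ha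
    exact ⟨h', fun ha => h' (h.le _ _ ha)⟩
  have hcancel : ∀ G : SimpleGraph α, ¬ G.Adj v w → (G ⊔ edge v w) \ edge v w = G := by
    intro G hG
    ext a b
    simp only [sdiff_adj, sup_adj, edge_adj]
    constructor
    · tauto
    · refine fun hab => ⟨.inl hab, ?_⟩
      rintro ⟨⟨rfl, rfl⟩ | ⟨rfl, rfl⟩, -⟩
      · exact hG hab
      · exact hG hab.symm
  refine Finset.card_bij' (fun p _ => (p.1 \ edge v w, p.2 \ edge v w))
    (fun p _ => (p.1 ⊔ edge v w, p.2 ⊔ edge v w)) ?_ ?_ ?_ ?_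
  · intro p hp
    rw [Finset.mem_filter] at hp
    obtain ⟨h1, h2⟩ := hle p hp.1 hp.2
    rw [mem_pairs, ← rootedMatching_delete_edge_iff hd hv hw (by simp [edge_adj, hne]), h1, h2]
    exact ⟨mem_pairs.1 hp.1, by simp [edge_adj, hne]⟩
  · intro p hp
    obtain ⟨h1, h2⟩ := hnot p hp
    rw [mem_pairs, ← rootedMatching_delete_edge_iff hd hv hw h1] at hp
    rw [Finset.mem_filter]
    have hm := mem_pairs (p := (p.1 ⊔ edge v w, p.2 ⊔ edge v w)).2 hp.1
    exact ⟨hm, (hf _ hm w).2 (by simp [edge_adj, hne])⟩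
  · intro p hp
    rw [Finset.mem_filter] at hp
    exact Prod.ext (hle p hp.1 hp.2).1 (hle p hp.1 hp.2).2
  · intro p hp
    exact Prod.ext (hcancel _ (hnot p hp).1) (hcancel _ (hnot p hp).2)

omit [Fintype α] in
lemma rootedMatching_insert_iff {N : Finset α} {v : α} {G M : SimpleGraph α} :
    RootedMatching (insert v N) ∅ ∅ ∅ G M ↔ RootedMatching N {v} ∅ ∅ G M := by
  constructor
  · rintro ⟨k1, k2, k3, k4, k5, k6, k7⟩
    refine ⟨⟨k1.1, ?_⟩, ?_, k3, k4, k5, k6, k7⟩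
    · intro x hx y hy _
      simp at hx hy
      rw [hx, hy]
    · intro a b hab
      simpa [or_comm] using k2 a b hab
  · rintro ⟨k1, k2, k3, k4, k5, k6, k7⟩
    refine ⟨⟨k1.1, ?_⟩, ?_, k3, k4, k5, k6, k7⟩
    · intro x hx
      simp at hx
    · intro a b hab
      simpa [or_comm] using k2 a b hab

lemma card_rootedMatching_empty :
    (pairs (RootedMatching (∅ : Finset α) ∅ ∅ ∅)).card = 1 := by
  rw [Finset.card_eq_one]
  refine ⟨(⊥, ⊥), ?_⟩
  ext ⟨G, M⟩
  rw [mem_pairs, Finset.mem_singleton, Prod.mk.injEq]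
  constructor
  · intro h
    have hG : G = ⊥ := by
      ext a b
      simpa using h.mem_of_adj a b
    subst hG
    refine ⟨rfl, ?_⟩
    ext a b
    simpa using h.le a b
  · rintro ⟨rfl, rfl⟩
    constructor <;> simp [Separated, isAcyclic_bot]

lemma card_rootedMatching_step {c : ℕ → ℕ → ℕ → ℕ → ℂ}
    (hw : ∀ n i j k, c n i j (k + 1) =
      ∑ l ∈ Finset.range (n + 1), (n.choose l : ℂ) * c (n - l) (i + l) j k)
    (hb : ∀ n i j k, c (n + 1) i (j + 1) k = (n + 1) * c n i j (k + 2))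
    (hb0 : ∀ i j k, c 0 i (j + 1) k = 0)
    (hy : ∀ n i j k, c n (i + 1) j k = c n i (j + 1) k +
      ∑ l ∈ Finset.range (n + 1), (n.choose l : ℂ) * c (n - l) i (j + l) k)
    (h1 : ∀ n, c (n + 1) 0 0 0 = c n 1 0 0) (h0 : c 0 0 0 0 = 1)
    (N Y B W : Finset α) (hd : Disj4 N Y B W)
    (ih : ∀ N' Y' B' W' : Finset α,
      (N'.card + Y'.card + B'.card + W'.card < N.card + Y.card + B.card + W.card ∨
        N'.card + Y'.card + B'.card + W'.card = N.card + Y.card + B.card + W.card ∧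
          (N'.card < N.card ∨ N'.card = N.card ∧ Y'.card < Y.card)) → Disj4 N' Y' B' W' →
      ((pairs (RootedMatching N' Y' B' W')).card : ℂ) = c N'.card Y'.card B'.card W'.card) :
    ((pairs (RootedMatching N Y B W)).card : ℂ) = c N.card Y.card B.card W.card := by
  have sub {U : Finset α} (hU : U ∈ N.powerset) : U ⊆ N := Finset.mem_powerset.1 hU
  have hsum (f : ℕ → ℂ) : ∑ l ∈ Finset.range (N.card + 1), (N.card.choose l : ℂ) * f l =
      ∑ U ∈ N.powerset, f U.card := by
    simp only [Finset.sum_powerset_apply_card, nsmul_eq_mul]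
  obtain ⟨hny, hnb, hnw, hyb, hyw, hbw⟩ := id hd
  rcases W.eq_empty_or_nonempty with rfl | ⟨v, hv⟩
  swap
  · obtain ⟨W, hvW, rfl⟩ : ∃ W', v ∉ W' ∧ insert v W' = W :=
      ⟨W.erase v, by simp, Finset.insert_erase hv⟩
    rw [card_rootedMatching_insert_unmatched hd hvW, Finset.card_insert_of_notMem hvW, hw, hsum,
      Nat.cast_sum]
    refine Finset.sum_congr rfl fun U hU => ?_
    have hUN := sub hU
    rw [Finset.disjoint_insert_right] at hnw hyw hbw
    have hYU : Disjoint Y U := hny.symm.mono_right hUN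
    have hNU := Finset.card_sdiff_add_card_eq_card hUN
    have hWc := Finset.card_insert_of_notMem hvW
    have hYc := Finset.card_union_of_disjoint hYU
    rw [ih (N \ U) (Y ∪ U) B W (by omega)
      ⟨Finset.disjoint_union_right.2 ⟨hny.mono_left Finset.sdiff_subset, Finset.sdiff_disjoint⟩,
        hnb.mono_left Finset.sdiff_subset, hnw.2.mono_left Finset.sdiff_subset,
        Finset.disjoint_union_left.2 ⟨hyb, hnb.mono_left hUN⟩,
        Finset.disjoint_union_left.2 ⟨hyw.2, hnw.2.mono_left hUN⟩, hbw.2⟩,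
      Finset.card_sdiff_of_subset hUN, hYc]
  rcases B.eq_empty_or_nonempty with rfl | ⟨v, hv⟩
  swap
  · obtain ⟨B, hvB, rfl⟩ : ∃ B', v ∉ B' ∧ insert v B' = B :=
      ⟨B.erase v, by simp, Finset.insert_erase hv⟩
    rw [card_rootedMatching_insert_matched hd hvB, Finset.card_insert_of_notMem hvB, Nat.cast_sum]
    rcases N.eq_empty_or_nonempty with rfl | hN
    · simp [hb0]
    obtain ⟨n, hn⟩ := Nat.exists_eq_succ_of_ne_zero hN.card_ne_zero
    rw [Finset.disjoint_insert_right] at hnb hyb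
    rw [hn, hb, Finset.sum_congr rfl (g := fun _ => c n Y.card B.card (0 + 2)), Finset.sum_const,
      hn, nsmul_eq_mul]
    · simp
    intro w hwN
    have hvw : v ∉ ({w} : Finset α) := by
      rw [Finset.mem_singleton]
      exact fun h => hnb.1 (h ▸ hwN)
    have hBc := Finset.card_insert_of_notMem hvB
    have hNc := Finset.card_erase_of_mem hwN
    have hWc : (insert v {w} : Finset α).card = 2 := by rw [Finset.card_insert_of_notMem hvw]; rfl
    have hNc' : (N.erase w).card = n := by omega
    rw [show insert v (insert w (∅ : Finset α)) = insert v {w} from rfl,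
      ih (N.erase w) Y B (insert v {w}) (by simp only [Finset.card_empty] at *; omega), hNc', hWc]
    have hwY := Finset.disjoint_left.1 hny hwN
    have hwB := Finset.disjoint_left.1 hnb.2 hwN
    refine ⟨hny.mono_left (Finset.erase_subset _ _), hnb.2.mono_left (Finset.erase_subset _ _),
      ?_, hyb.2, ?_, ?_⟩
    · simp [hnb.1]
    · simp [hyb.1, hwY]
    · simp [hvB, hwB]
  rcases Y.eq_empty_or_nonempty with rfl | ⟨v, hv⟩
  swap
  · obtain ⟨Y, hvY, rfl⟩ : ∃ Y', v ∉ Y' ∧ insert v Y' = Y :=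
      ⟨Y.erase v, by simp, Finset.insert_erase hv⟩
    rw [Finset.disjoint_insert_right] at hny
    have hYc := Finset.card_insert_of_notMem hvY
    rw [card_rootedMatching_insert_free hd hvY, Finset.card_insert_of_notMem hvY,
      Finset.card_empty, hy, hsum, Nat.cast_add, Nat.cast_sum]
    congr 1
    · rw [insert_empty_eq, ih N Y {v} ∅
        (by rw [hYc]; simp [add_assoc])
        ⟨hny.2, by simp [hny.1], by simp, by simp [hvY], by simp, by simp⟩]
      simp
    refine Finset.sum_congr rfl fun U hU => ?_
    have hUN := sub hU
    have hNU := Finset.card_sdiff_add_card_eq_card hUN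
    rw [Finset.empty_union, ih (N \ U) Y U ∅
        (by simp only [Finset.card_empty] at *; omega)
        ⟨hny.2.mono_left Finset.sdiff_subset, Finset.sdiff_disjoint, by simp,
          hny.2.symm.mono_right hUN, by simp, by simp⟩,
      Finset.card_sdiff_of_subset hUN, zero_add, Finset.card_empty]
  rcases N.eq_empty_or_nonempty with rfl | ⟨v, hv⟩
  · rw [card_rootedMatching_empty]
    simp [h0]
  · obtain ⟨N, hvN, rfl⟩ : ∃ N', v ∉ N' ∧ insert v N' = N :=
      ⟨N.erase v, by simp, Finset.insert_erase hv⟩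
    have hNc := Finset.card_insert_of_notMem hvN
    rw [pairs_congr fun _ _ => rootedMatching_insert_iff,
      ih N {v} ∅ ∅
        (by simp only [Finset.card_empty, Finset.card_singleton] at *; omega)
        ⟨by simp [hvN], by simp, by simp, by simp, by simp, by simp⟩, hNc]
    simp [h1]

/-- A function satisfying the recurrences obtained by deleting roots counts rooted matchings. -/
theorem card_rootedMatching_eq {c : ℕ → ℕ → ℕ → ℕ → ℂ}
    (hw : ∀ n i j k, c n i j (k + 1) =
      ∑ l ∈ Finset.range (n + 1), (n.choose l : ℂ) * c (n - l) (i + l) j k)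
    (hb : ∀ n i j k, c (n + 1) i (j + 1) k = (n + 1) * c n i j (k + 2))
    (hb0 : ∀ i j k, c 0 i (j + 1) k = 0)
    (hy : ∀ n i j k, c n (i + 1) j k = c n i (j + 1) k +
      ∑ l ∈ Finset.range (n + 1), (n.choose l : ℂ) * c (n - l) i (j + l) k)
    (h1 : ∀ n, c (n + 1) 0 0 0 = c n 1 0 0) (h0 : c 0 0 0 0 = 1)
    (N Y B W : Finset α) (hd : Disj4 N Y B W) :
    ((pairs (RootedMatching N Y B W)).card : ℂ) = c N.card Y.card B.card W.card :=
  card_rootedMatching_step hw hb hb0 hy h1 h0 N Y B W hd fun N' Y' B' W' _ hd' =>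
    card_rootedMatching_eq hw hb hb0 hy h1 h0 N' Y' B' W' hd'
termination_by (N.card + Y.card + B.card + W.card, N.card, Y.card)
decreasing_by
  simpa only [Prod.lex_def]

end Counting

end SimpleGraph

lemma isMaximalMatching_edgeSet_iff {V : Type*} {G M : SimpleGraph V} :
    IsMaximalMatching G M.edgeSet ↔
      (∀ a b, M.Adj a b → G.Adj a b) ∧ (∀ a b c, M.Adj a b → M.Adj a c → b = c) ∧
      ∀ a b, G.Adj a b → (∃ c, M.Adj a c) ∨ ∃ c, M.Adj b c := by
  constructor
  · rintro ⟨⟨h1, h2⟩, h3⟩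
    refine ⟨fun a b => @h1 s(a, b), fun a b c hb hc => ?_, fun a b hab => ?_⟩
    · by_contra hne
      refine h2 s(a, b) hb s(a, c) hc (fun h => hne (Sym2.congr_right.1 h)) a (by simp) (by simp)
    · by_contra! hno
      refine h3 (insert s(a, b) M.edgeSet) ⟨?_, ?_⟩ ⟨Set.subset_insert _ _, fun h => hno.1 b ?_⟩
      · exact Set.insert_subset hab h1
      · have key : ∀ v ∈ s(a, b), ∀ f ∈ M.edgeSet, v ∉ f := by
          intro v hv f hf hvf
          obtain ⟨w, rfl⟩ := Sym2.mem_iff_exists.1 hvf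
          rcases Sym2.mem_iff.1 hv with rfl | rfl
          · exact hno.1 _ hf
          · exact hno.2 _ hf
        rintro e (rfl | he) f (rfl | hf) hef v hve hvf
        · exact hef rfl
        · exact key v hve f hf hvf
        · exact key v hvf e he hve
        · exact h2 e he f hf hef v hve hvf
      · exact h (Set.mem_insert _ _)
  · rintro ⟨h1, h2, h3⟩
    refine ⟨⟨?_, ?_⟩, ?_⟩
    · rintro ⟨a, b⟩ h
      exact h1 a b h
    · intro e he f hf hef v hve hvf
      obtain ⟨b, rfl⟩ := Sym2.mem_iff_exists.1 hve
      obtain ⟨c, rfl⟩ := Sym2.mem_iff_exists.1 hvf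
      exact hef (by rw [h2 v b c he hf])
    · intro M' hM' hlt
      obtain ⟨e, he, heM⟩ := Set.exists_of_ssubset hlt
      have key : ∀ v ∈ e, ∀ c, ¬ M.Adj v c := by
        intro v hv c hc
        exact hM'.2 e he s(v, c) (hlt.1 hc) (fun h => heM (h ▸ hc)) v hv (by simp)
      induction e with
      | h a b =>
        rcases h3 a b (hM'.1 he) with ⟨c, hc⟩ | ⟨c, hc⟩
        · exact key a (by simp) c hc
        · exact key b (by simp) c hc

lemma acyclic_maximalMatching_iff_rootedMatching {n : ℕ} {G M : SimpleGraph (Fin n)} :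
    G.IsAcyclic ∧ IsMaximalMatching G M.edgeSet ↔
      SimpleGraph.RootedMatching Finset.univ ∅ ∅ ∅ G M := by
  rw [isMaximalMatching_edgeSet_iff]
  constructor
  · rintro ⟨h1, h2, h3, h4⟩
    exact ⟨⟨h1, by simp [SimpleGraph.Separated]⟩, by simp, h2, h3, by simp, by simp,
      fun a b h _ _ => h4 a b h⟩
  · rintro ⟨h1, -, h2, h3, -, -, h4⟩
    exact ⟨h1.1, h2, h3, fun a b h => h4 a b h (by simp) (by simp)⟩

lemma mN_eq_card (n : ℕ) :
    mN n = (SimpleGraph.pairs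
      (SimpleGraph.RootedMatching (Finset.univ : Finset (Fin n)) ∅ ∅ ∅)).card := by
  have hS : ∀ p : MMSpace n, (SimpleGraph.fromEdgeSet p.1.2).edgeSet = p.1.2 := by
    intro p
    rw [SimpleGraph.edgeSet_fromEdgeSet, sdiff_eq_left, Set.disjoint_left]
    exact fun e he hd => p.1.1.not_isDiag_of_mem_edgeSet (p.2.2.1.1 he) hd
  rw [mN, ← Fintype.card_coe, ← Nat.card_eq_fintype_card]
  refine Nat.card_congr
    { toFun := fun p => ⟨(p.1.1, SimpleGraph.fromEdgeSet p.1.2), ?_⟩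
      invFun := fun q => ⟨(q.1.1, q.1.2.edgeSet), ?_⟩
      left_inv := fun p => Subtype.ext (Prod.ext rfl (hS p))
      right_inv := fun q => Subtype.ext (Prod.ext rfl (SimpleGraph.fromEdgeSet_edgeSet _)) }
  · rw [SimpleGraph.mem_pairs, ← acyclic_maximalMatching_iff_rootedMatching, hS]
    exact p.2
  · exact acyclic_maximalMatching_iff_rootedMatching.2 (SimpleGraph.mem_pairs.1 q.2)

lemma mN_eq_of_recurrence {c : ℕ → ℕ → ℕ → ℕ → ℂ}
    (hw : ∀ n i j k, c n i j (k + 1) =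
      ∑ l ∈ Finset.range (n + 1), (n.choose l : ℂ) * c (n - l) (i + l) j k)
    (hb : ∀ n i j k, c (n + 1) i (j + 1) k = (n + 1) * c n i j (k + 2))
    (hb0 : ∀ i j k, c 0 i (j + 1) k = 0)
    (hy : ∀ n i j k, c n (i + 1) j k = c n i (j + 1) k +
      ∑ l ∈ Finset.range (n + 1), (n.choose l : ℂ) * c (n - l) i (j + l) k)
    (h1 : ∀ n, c (n + 1) 0 0 0 = c n 1 0 0) (h0 : c 0 0 0 0 = 1) (n : ℕ) :
    (mN n : ℂ) = c n 0 0 0 := by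
  rw [mN_eq_card, SimpleGraph.card_rootedMatching_eq hw hb hb0 hy h1 h0]
  · simp
  · constructor <;> simp

section Coefficients

/-- The coefficient of `z ^ n` in the Laurent expansion of `F` on the circle of radius `r`. -/
noncomputable def coef (r : ℝ) (n : ℤ) (F : ℂ → ℂ) : ℂ :=
  (2 * Real.pi * Complex.I)⁻¹ * ∮ z in C(0, r), z ^ (-(n + 1)) * F z

variable {r : ℝ} {F G : ℂ → ℂ}

lemma circleIntegrable_zpow_mul (hr : 0 < r) (k : ℤ) (hF : Differentiable ℂ F) :
    CircleIntegrable (fun z => z ^ k * F z) 0 r := by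
  refine ContinuousOn.circleIntegrable hr.le fun z hz => ?_
  have hz0 : z ≠ 0 := ne_zero_of_mem_sphere hr.ne' ⟨z, hz⟩
  exact ((continuousAt_zpow₀ z k (.inl hz0)).mul hF.continuous.continuousAt).continuousWithinAt

lemma coef_add (hr : 0 < r) (n : ℤ) (hF : Differentiable ℂ F) (hG : Differentiable ℂ G) :
    coef r n (fun z => F z + G z) = coef r n F + coef r n G := by
  simp only [coef, mul_add]
  rw [circleIntegral.integral_add (circleIntegrable_zpow_mul hr _ hF)
    (circleIntegrable_zpow_mul hr _ hG), mul_add]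

lemma coef_const_mul (n : ℤ) (c : ℂ) (F : ℂ → ℂ) :
    coef r n (fun z => c * F z) = c * coef r n F := by
  simp only [coef, mul_left_comm _ c]
  rw [circleIntegral.integral_const_mul]
  ring

lemma coef_sub (hr : 0 < r) (n : ℤ) (hF : Differentiable ℂ F) (hG : Differentiable ℂ G) :
    coef r n (fun z => F z - G z) = coef r n F - coef r n G := by
  have := coef_add hr n (hF.sub hG) hG
  simp only [Pi.sub_apply, sub_add_cancel] at this
  exact eq_sub_of_add_eq this.symm

lemma coef_sum {ι : Type*} (hr : 0 < r) (n : ℤ) (s : Finset ι) {F : ι → ℂ → ℂ}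
    (hF : ∀ i ∈ s, Differentiable ℂ (F i)) :
    coef r n (fun z => ∑ i ∈ s, F i z) = ∑ i ∈ s, coef r n (F i) := by
  classical
  induction s using Finset.induction_on with
  | empty => simp [coef, circleIntegral]
  | insert a s ha ih =>
    simp only [Finset.sum_insert ha]
    rw [coef_add hr n (hF a (by simp)) (Differentiable.fun_sum fun i hi => hF i (by simp [hi])),
      ih fun i hi => hF i (by simp [hi])]

lemma coef_pow_mul (hr : 0 < r) (n : ℤ) (l : ℕ) (F : ℂ → ℂ) :
    coef r n (fun z => z ^ l * F z) = coef r (n - l) F := by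
  rw [coef, coef]
  congr 1
  refine circleIntegral.integral_congr hr.le fun z hz => ?_
  have hz0 : z ≠ 0 := ne_zero_of_mem_sphere hr.ne' ⟨z, hz⟩
  rw [← mul_assoc, ← zpow_natCast, ← zpow_add₀ hz0]
  congr 2
  ring

lemma coef_mul_self (hr : 0 < r) (n : ℤ) (F : ℂ → ℂ) :
    coef r n (fun z => z * F z) = coef r (n - 1) F := by
  simpa using coef_pow_mul hr n 1 F

lemma coef_deriv (hr : 0 < r) (n : ℤ) {F' : ℂ → ℂ} (hF : ∀ z, HasDerivAt F (F' z) z)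
    (hF' : Differentiable ℂ F') :
    coef r n F' = (n + 1) * coef r (n + 1) F := by
  have hFd : Differentiable ℂ F := fun z => (hF z).differentiableAt
  have h := circleIntegral.integral_eq_zero_of_hasDerivWithinAt (c := 0) (R := r) hr.le
    (f := fun z => z ^ (-(n + 1)) * F z)
    (f' := fun z => z ^ (-(n + 1)) * F' z - (n + 1) * (z ^ (-(n + 1 + 1)) * F z)) fun z hz => by
      have hz0 : z ≠ 0 := ne_zero_of_mem_sphere hr.ne' ⟨z, hz⟩
      refine (((hasDerivAt_zpow (-(n + 1)) z (.inl hz0)).mul (hF z)).congr_deriv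
        ?_).hasDerivWithinAt
      rw [show (-(n + 1 + 1) : ℤ) = -(n + 1) - 1 by ring]
      push_cast
      ring
  rw [circleIntegral.integral_sub (circleIntegrable_zpow_mul hr _ hF')
    (by simpa only [mul_left_comm] using
      circleIntegrable_zpow_mul hr (-(n + 1 + 1)) (hFd.const_mul (n + 1 : ℂ))),
      circleIntegral.integral_const_mul,
    sub_eq_zero] at h
  rw [coef, coef, h]
  ring

lemma coef_eq_zero_of_tendsto (hr : 0 < r) (n : ℤ) (hF : Differentiable ℂ F)
    (h0 : Tendsto (fun z => z ^ (-(n + 1)) * F z) (𝓝[≠] 0) (𝓝 ((0 : ℂ) ^ (-(n + 1)) * F 0))) :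
    coef r n F = 0 := by
  rw [coef, Complex.circleIntegral_eq_zero_of_differentiable_on_off_countable hr.le
    (Set.countable_singleton 0), mul_zero]
  · intro z _
    by_cases hz : z = 0
    · subst hz
      exact (continuousAt_iff_punctured_nhds.2 h0).continuousWithinAt
    · exact ((continuousAt_zpow₀ z _ (.inl hz)).mul hF.continuous.continuousAt).continuousWithinAt
  · intro z hz
    exact (differentiableAt_zpow.2 (.inl hz.2)).mul (hF z)

lemma coef_of_neg (hr : 0 < r) {n : ℤ} (hn : n < 0) (hF : Differentiable ℂ F) :
    coef r n F = 0 := by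
  refine coef_eq_zero_of_tendsto hr n hF (Tendsto.mono_left ?_ nhdsWithin_le_nhds)
  exact (continuousAt_zpow₀ 0 _ (.inr (by omega))).mul hF.continuous.continuousAt

lemma coef_zero (hr : 0 < r) (hF : Differentiable ℂ F) : coef r 0 F = F 0 := by
  have h := hF.differentiableOn (s := Metric.closedBall 0 r) |>.circleIntegral_sub_inv_smul
    (w := 0) (Metric.mem_ball_self hr)
  simp only [sub_zero, smul_eq_mul] at h
  have h2 : (2 * Real.pi * Complex.I : ℂ) ≠ 0 := by simp [Real.pi_ne_zero]
  simp only [coef, zero_add, zpow_neg_one]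
  rw [h, inv_mul_cancel_left₀ h2]

lemma coef_mul_exp (hr : 0 < r) (n : ℕ) {X u : ℂ → ℂ} (hX : Differentiable ℂ X)
    (hu : Differentiable ℂ u) :
    coef r n (fun z => X z * Complex.exp (z * u z)) =
      ∑ l ∈ Finset.range (n + 1), (l.factorial : ℂ)⁻¹ *
        coef r (n - l) (fun z => X z * u z ^ l) := by
  have hd : ∀ l : ℕ, Differentiable ℂ fun z => (l.factorial : ℂ)⁻¹ * (z ^ l * (X z * u z ^ l)) := by
    intro l; fun_prop
  have hdS : Differentiable ℂ fun z => ∑ l ∈ Finset.range (n + 2),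
      (l.factorial : ℂ)⁻¹ * (z ^ l * (X z * u z ^ l)) := by fun_prop
  have hdE : Differentiable ℂ fun z => X z * Complex.exp (z * u z) := by fun_prop
  have hzero : coef r n (fun z => X z * Complex.exp (z * u z) - ∑ l ∈ Finset.range (n + 2),
      (l.factorial : ℂ)⁻¹ * (z ^ l * (X z * u z ^ l))) = 0 := by
    refine coef_eq_zero_of_tendsto hr n (hdE.sub hdS) ?_
    rw [zero_zpow _ (by omega), zero_mul]
    have hlim : Tendsto (fun z : ℂ => z * (X z * u z ^ (n + 2))) (𝓝[≠] 0) (𝓝 0) := by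
      have : Continuous fun z : ℂ => z * (X z * u z ^ (n + 2)) := by
        have := hX.continuous
        have := hu.continuous
        fun_prop
      simpa using (this.tendsto 0).mono_left nhdsWithin_le_nhds
    have hsmall : ∀ᶠ z in 𝓝[≠] (0 : ℂ), ‖z * u z‖ ≤ 1 := by
      have : Continuous fun z : ℂ => ‖z * u z‖ := by
        have := hu.continuous
        fun_prop
      refine ((this.tendsto 0).mono_left nhdsWithin_le_nhds).eventually_le_const ?_
      simp
    set C : ℝ := (n + 2).succ * (((n + 2).factorial : ℝ) * (n + 2 : ℕ))⁻¹
    refine squeeze_zero_norm' (a := fun z => ‖z * (X z * u z ^ (n + 2))‖ * C) ?_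
      (by simpa using hlim.norm.mul_const C)
    filter_upwards [hsmall, self_mem_nhdsWithin] with z hz hz0
    have hz0 : z ≠ 0 := hz0
    have hb := Complex.exp_bound hz (n := n + 2) (by omega)
    have heq : X z * Complex.exp (z * u z) - ∑ l ∈ Finset.range (n + 2),
        (l.factorial : ℂ)⁻¹ * (z ^ l * (X z * u z ^ l)) = X z * (Complex.exp (z * u z) -
          ∑ m ∈ Finset.range (n + 2), (z * u z) ^ m / (m.factorial : ℂ)) := by
      rw [mul_sub, Finset.mul_sum]
      congr 1
      refine Finset.sum_congr rfl fun l _ => ?_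
      rw [mul_pow]
      ring
    rw [heq, norm_mul, norm_mul, norm_zpow]
    have hzn : ‖z‖ ≠ 0 := norm_ne_zero_iff.2 hz0
    calc ‖z‖ ^ (-((n : ℤ) + 1)) * (‖X z‖ * _)
        ≤ ‖z‖ ^ (-((n : ℤ) + 1)) * (‖X z‖ * (‖z * u z‖ ^ (n + 2) * C)) := by gcongr
      _ = ‖z * (X z * u z ^ (n + 2))‖ * C := by
        simp only [norm_mul, norm_pow, mul_pow]
        have : ‖z‖ ^ (-((n : ℤ) + 1)) * ‖z‖ ^ (n + 2) = ‖z‖ := by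
          rw [← zpow_natCast, ← zpow_add₀ hzn]
          push_cast
          rw [show (-((n : ℤ) + 1) + (n + 2)) = 1 by ring, zpow_one]
        linear_combination ‖X z‖ * ‖u z‖ ^ (n + 2) * C * this
  rw [coef_sub hr n hdE hdS, sub_eq_zero, coef_sum hr n _ fun l _ => hd l] at hzero
  rw [hzero, Finset.sum_range_succ]
  simp only [coef_const_mul, coef_pow_mul hr]
  rw [coef_of_neg (n := (n : ℤ) - ((n + 1 : ℕ) : ℤ)) hr (by push_cast; omega) (by fun_prop),
    mul_zero, add_zero]

end Coefficients

section GeneratingFunctions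

/-- The function `ψ` such that `z = a e ^ (-ψ a)` relates the variable `z` of the exponential
generating functions to the uniformizing parameter `a`. -/
noncomputable def psi (z : ℂ) : ℂ := z ^ 2 * Complex.exp (2 * z)

/-- The derivative of `psi`. -/
noncomputable def psiDeriv (z : ℂ) : ℂ := (2 * z + 2 * z ^ 2) * Complex.exp (2 * z)

/-- The Jacobian factor `1 - a ψ'(a)` in Lagrange inversion. -/
noncomputable def jac (z : ℂ) : ℂ := 1 - z * psiDeriv z

/-- The generating function of trees with a maximal matching. -/
noncomputable def treeGF (z : ℂ) : ℂ := z - psi z ^ 2 / 2 + (1 / 2 - z) * psi z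

/-- The generating function of forests with a maximal matching. -/
noncomputable def forestGF (z : ℂ) : ℂ := Complex.exp (treeGF z)

/-- The generating function of rooted trees with a maximal matching. -/
noncomputable def freeGF (z : ℂ) : ℂ := Complex.exp (psi z) * (1 + z * Complex.exp (2 * z))

/-- The generating function of rooted trees with a maximal matching covering the root. -/
noncomputable def matchedGF (z : ℂ) : ℂ := z * Complex.exp (2 * z + psi z)

/-- The generating function of rooted trees with a matching not covering the root and maximal away
from the root. -/
noncomputable def unmatchedGF (z : ℂ) : ℂ := Complex.exp (z + psi z)

@[fun_prop]
lemma differentiable_psi : Differentiable ℂ psi := by unfold psi; fun_prop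

@[fun_prop]
lemma differentiable_psiDeriv : Differentiable ℂ psiDeriv := by unfold psiDeriv; fun_prop

@[fun_prop]
lemma differentiable_jac : Differentiable ℂ jac := by unfold jac; fun_prop

@[fun_prop]
lemma differentiable_treeGF : Differentiable ℂ treeGF := by unfold treeGF; fun_prop

@[fun_prop]
lemma differentiable_forestGF : Differentiable ℂ forestGF := by unfold forestGF; fun_prop

@[fun_prop]
lemma differentiable_freeGF : Differentiable ℂ freeGF := by unfold freeGF; fun_prop

@[fun_prop]
lemma differentiable_matchedGF : Differentiable ℂ matchedGF := by unfold matchedGF; fun_prop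

@[fun_prop]
lemma differentiable_unmatchedGF : Differentiable ℂ unmatchedGF := by unfold unmatchedGF; fun_prop

lemma hasDerivAt_psi (z : ℂ) : HasDerivAt psi (psiDeriv z) z := by
  have h1 : HasDerivAt (fun z : ℂ => Complex.exp (2 * z)) (Complex.exp (2 * z) * (2 * 1)) z :=
    ((hasDerivAt_id z).const_mul 2).cexp
  refine ((hasDerivAt_pow 2 z).mul h1).congr_deriv ?_
  simp only [psiDeriv]
  push_cast
  ring

lemma hasDerivAt_treeGF (z : ℂ) :
    HasDerivAt treeGF ((1 + z * Complex.exp (2 * z)) * jac z) z := by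
  have h := hasDerivAt_psi z
  have h1 := ((hasDerivAt_id z).sub ((h.pow 2).div_const 2)).add
    (((hasDerivAt_id z).const_sub (1 / 2)).mul h)
  refine h1.congr_deriv ?_
  simp only [jac, psiDeriv, psi, id]
  push_cast
  ring

lemma hasDerivAt_forestGF (z : ℂ) :
    HasDerivAt forestGF ((1 + z * Complex.exp (2 * z)) * jac z * forestGF z) z := by
  refine (hasDerivAt_treeGF z).cexp.congr_deriv ?_
  rw [forestGF]
  ring

lemma unmatchedGF_eq (z : ℂ) :
    unmatchedGF z = Complex.exp (z * (Complex.exp (-psi z) * freeGF z)) := by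
  rw [freeGF, ← mul_assoc (Complex.exp _), ← Complex.exp_add, neg_add_cancel, Complex.exp_zero,
    unmatchedGF, psi]
  ring_nf

lemma exp_neg_psi_mul_matchedGF (z : ℂ) :
    z * (Complex.exp (-psi z) * matchedGF z) = psi z := by
  rw [matchedGF, mul_left_comm (Complex.exp _), ← Complex.exp_add,
    show -psi z + (2 * z + psi z) = 2 * z by ring, psi]
  ring

lemma freeGF_eq (z : ℂ) :
    freeGF z = matchedGF z + Complex.exp (z * (Complex.exp (-psi z) * matchedGF z)) := by
  rw [exp_neg_psi_mul_matchedGF, freeGF, matchedGF, Complex.exp_add]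
  ring

lemma matchedGF_eq (z : ℂ) :
    matchedGF z = z * (Complex.exp (-psi z) * unmatchedGF z ^ 2) := by
  rw [matchedGF, unmatchedGF, ← Complex.exp_nat_mul, ← Complex.exp_add]
  congr 2
  push_cast
  ring

variable {r : ℝ} {H : ℂ → ℂ}

/-- `n!` times the coefficient of `z ^ n` in the power series `H (a z)`, computed by Lagrange
inversion. -/
noncomputable def lagrange (r : ℝ) (n : ℕ) (H : ℂ → ℂ) : ℂ :=
  n.factorial * coef r n (fun z => H z * jac z * Complex.exp (n * psi z))

lemma lagrange_add (hr : 0 < r) (n : ℕ) {G : ℂ → ℂ} (hH : Differentiable ℂ H)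
    (hG : Differentiable ℂ G) :
    lagrange r n (fun z => H z + G z) = lagrange r n H + lagrange r n G := by
  simp only [lagrange, add_mul]
  rw [coef_add hr n (by fun_prop) (by fun_prop), mul_add]

lemma lagrange_mul_exp (hr : 0 < r) (n : ℕ) {g : ℂ → ℂ} (hH : Differentiable ℂ H)
    (hg : Differentiable ℂ g) :
    lagrange r n (fun z => H z * Complex.exp (z * (Complex.exp (-psi z) * g z))) =
      ∑ l ∈ Finset.range (n + 1), (n.choose l : ℂ) *
        lagrange r (n - l) (fun z => H z * g z ^ l) := by
  have h := coef_mul_exp hr n (X := fun z => H z * jac z * Complex.exp (n * psi z))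
    (u := fun z => Complex.exp (-psi z) * g z) (by fun_prop) (by fun_prop)
  simp only [lagrange]
  rw [show (fun z => H z * Complex.exp (z * (Complex.exp (-psi z) * g z)) * jac z *
    Complex.exp (n * psi z)) = fun z => H z * jac z * Complex.exp (n * psi z) *
      Complex.exp (z * (Complex.exp (-psi z) * g z)) by ext z; ring, h, Finset.mul_sum]
  refine Finset.sum_congr rfl fun l hl => ?_
  have hln : l ≤ n := Nat.lt_succ_iff.1 (Finset.mem_range.1 hl)
  rw [← mul_assoc, ← mul_assoc, Nat.cast_choose ℂ hln, Nat.cast_sub hln]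
  congr 1
  · have h1 : (l.factorial : ℂ) ≠ 0 := by exact_mod_cast l.factorial_ne_zero
    have h2 : ((n - l).factorial : ℂ) ≠ 0 := by exact_mod_cast (n - l).factorial_ne_zero
    field_simp
  · congr 1
    ext z
    have : Complex.exp (n * psi z) * Complex.exp (-psi z) ^ l =
        Complex.exp (((n - l : ℕ) : ℂ) * psi z) := by
      rw [← Complex.exp_nat_mul, ← Complex.exp_add, Nat.cast_sub hln]
      congr 1
      ring
    rw [← this, mul_pow]
    ring

lemma lagrange_succ_mul (hr : 0 < r) (n : ℕ) (H : ℂ → ℂ) :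
    lagrange r (n + 1) (fun z => z * (Complex.exp (-psi z) * H z)) =
      (n + 1) * lagrange r n H := by
  have h := coef_mul_self hr (n + 1 : ℕ) (fun z => H z * jac z * Complex.exp (n * psi z))
  simp only [lagrange, Nat.factorial_succ]
  push_cast at h ⊢
  rw [add_sub_cancel_right] at h
  rw [← mul_assoc, ← h]
  congr 2
  ext z
  have : Complex.exp (-psi z) * Complex.exp ((n + 1) * psi z) = Complex.exp (n * psi z) := by
    rw [← Complex.exp_add]
    congr 1
    ring
  rw [← this]
  ring

lemma lagrange_zero_mul (hr : 0 < r) (hH : Differentiable ℂ H) :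
    lagrange r 0 (fun z => z * H z) = 0 := by
  have h := coef_mul_self hr 0 (fun z => H z * jac z * Complex.exp (0 * psi z))
  rw [coef_of_neg (n := 0 - 1) hr (by norm_num) (by fun_prop)] at h
  simp only [lagrange, mul_assoc, Nat.cast_zero] at h ⊢
  rw [h, mul_zero]

lemma mul_coef_jac (hr : 0 < r) (N : ℤ) {H' : ℂ → ℂ} (hH : ∀ z, HasDerivAt H (H' z) z)
    (hH' : Differentiable ℂ H') :
    N * coef r N (fun z => H z * jac z * Complex.exp (N * psi z)) =
      coef r (N - 1) (fun z => H' z * Complex.exp (N * psi z)) := by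
  have hHd : Differentiable ℂ H := fun z => (hH z).differentiableAt
  have h1 := coef_deriv hr (N - 1) (F := fun z => H z * Complex.exp (N * psi z))
    (F' := fun z => H' z * Complex.exp (N * psi z) +
      H z * (Complex.exp (N * psi z) * (N * psiDeriv z)))
    (fun z => (hH z).mul ((hasDerivAt_psi z).const_mul (N : ℂ)).cexp) (by fun_prop)
  have h2 := coef_mul_self hr N (fun z => H z * (Complex.exp (N * psi z) * (N * psiDeriv z)))
  rw [coef_add hr _ (by fun_prop) (by fun_prop)] at h1
  have h3 : (fun z => H z * jac z * Complex.exp (N * psi z)) = fun z =>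
      H z * Complex.exp (N * psi z) - H z * Complex.exp (N * psi z) * (z * psiDeriv z) := by
    ext z
    rw [jac]
    ring
  have h4 : (fun z => z * (H z * (Complex.exp (N * psi z) * (N * psiDeriv z)))) = fun z =>
      N * (H z * Complex.exp (N * psi z) * (z * psiDeriv z)) := by
    ext z
    ring
  rw [h4, coef_const_mul] at h2
  rw [h3, coef_sub hr N (by fun_prop) (by fun_prop), mul_sub, h2, sub_eq_iff_eq_add, h1]
  push_cast
  ring_nf

lemma lagrange_forestGF_succ (hr : 0 < r) (n : ℕ) :
    lagrange r (n + 1) forestGF = lagrange r n (fun z => forestGF z * freeGF z) := by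
  have h := mul_coef_jac hr (n + 1 : ℕ) hasDerivAt_forestGF (by fun_prop)
  simp only [lagrange, Nat.factorial_succ]
  push_cast at h ⊢
  rw [add_sub_cancel_right] at h
  rw [mul_comm ((n : ℂ) + 1), mul_assoc, h]
  congr 2
  ext z
  rw [freeGF, show ((n : ℂ) + 1) * psi z = psi z + n * psi z by ring, Complex.exp_add]
  ring

lemma mN_eq_lagrange (hr : 0 < r) (n : ℕ) : (mN n : ℂ) = lagrange r n forestGF := by
  have key := mN_eq_of_recurrence (c := fun n i j k => lagrange r n fun z =>
    forestGF z * freeGF z ^ i * matchedGF z ^ j * unmatchedGF z ^ k) ?_ ?_ ?_ ?_ ?_ ?_ n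
  · simpa using key
  · intro n i j k
    have h := lagrange_mul_exp hr n (g := freeGF)
      (H := fun z => forestGF z * freeGF z ^ i * matchedGF z ^ j * unmatchedGF z ^ k)
      (by fun_prop) (by fun_prop)
    simp only [← unmatchedGF_eq] at h
    simp only [pow_succ, ← mul_assoc, h, pow_add]
    refine Finset.sum_congr rfl fun l _ => ?_
    congr 2
    ext z
    ring
  · intro n i j k
    have h := lagrange_succ_mul hr n
      (fun z => forestGF z * freeGF z ^ i * matchedGF z ^ j * unmatchedGF z ^ (k + 2))
    rw [← h]
    congr 1
    ext z
    rw [pow_succ (matchedGF z), pow_add (unmatchedGF z)]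
    nth_rewrite 2 [matchedGF_eq]
    ring
  · intro i j k
    have h := lagrange_zero_mul hr (H := fun z => forestGF z * freeGF z ^ i * matchedGF z ^ j *
      unmatchedGF z ^ k * Complex.exp (2 * z + psi z)) (by fun_prop)
    rw [← h]
    congr 1
    ext z
    rw [pow_succ (matchedGF z)]
    nth_rewrite 2 [matchedGF]
    ring
  · intro n i j k
    have h := lagrange_mul_exp hr n (g := matchedGF)
      (H := fun z => forestGF z * freeGF z ^ i * matchedGF z ^ j * unmatchedGF z ^ k)
      (by fun_prop) (by fun_prop)
    rw [show (fun z => forestGF z * freeGF z ^ (i + 1) * matchedGF z ^ j * unmatchedGF z ^ k) =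
      fun z => forestGF z * freeGF z ^ i * matchedGF z ^ (j + 1) * unmatchedGF z ^ k +
        forestGF z * freeGF z ^ i * matchedGF z ^ j * unmatchedGF z ^ k *
          Complex.exp (z * (Complex.exp (-psi z) * matchedGF z)) by
        ext z
        rw [pow_succ (freeGF z)]
        nth_rewrite 2 [freeGF_eq]
        ring, lagrange_add hr n (by fun_prop) (by fun_prop), h]
    congr 1
    refine Finset.sum_congr rfl fun l _ => ?_
    congr 2
    ext z
    ring
  · intro n
    simpa using lagrange_forestGF_succ hr n
  · simp only [lagrange]
    rw [Nat.cast_zero, coef_zero hr (by fun_prop)]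
    simp [jac, forestGF, treeGF, psi]

/-- The derivative of `(z + ψ z) * forestGF z`, times `z`. -/
noncomputable def saddleAmplitude (z : ℂ) : ℂ :=
  z * ((1 + psiDeriv z) * forestGF z +
    (z + psi z) * ((1 + z * Complex.exp (2 * z)) * jac z * forestGF z))

@[fun_prop]
lemma differentiable_saddleAmplitude : Differentiable ℂ saddleAmplitude := by
  unfold saddleAmplitude; fun_prop

lemma sq_mul_mN_eq (hr : 0 < r) (n : ℕ) :
    (n : ℂ) ^ 2 * (mN n : ℂ) = n.factorial *
      coef r n (fun z => saddleAmplitude z * Complex.exp (n * psi z)) := by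
  have h1 := mul_coef_jac hr n hasDerivAt_forestGF (by fun_prop)
  have h2 := mul_coef_jac hr n (H := fun z => (z + psi z) * forestGF z)
    (fun z => ((hasDerivAt_id z).add (hasDerivAt_psi z)).mul (hasDerivAt_forestGF z))
    (by fun_prop)
  rw [← coef_mul_self hr] at h1 h2
  rw [mN_eq_lagrange hr, lagrange]
  push_cast at h1 h2
  have h3 : (fun z => z * ((1 + z * Complex.exp (2 * z)) * jac z * forestGF z *
      Complex.exp (n * psi z))) =
      fun z => (z + psi z) * forestGF z * jac z * Complex.exp (n * psi z) := by
    ext z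
    rw [psi]
    ring
  rw [h3] at h1
  rw [show (n : ℂ) ^ 2 * (n.factorial * coef r n fun z => forestGF z * jac z *
    Complex.exp (n * psi z)) = n.factorial * (n * (n * coef r n fun z => forestGF z * jac z *
    Complex.exp (n * psi z))) by ring, h1, h2]
  congr 2
  ext z
  simp only [saddleAmplitude, Pi.add_apply, id]
  ring

end GeneratingFunctions

section SaddlePoint

lemma tendsto_sqrt_mul_integral_exp {k Q S : ℝ → ℂ} {b c : ℝ} (hk : Continuous k)
    (hQ : Continuous Q) (hS : ∀ θ, Q θ = θ ^ 2 * S θ) (hS0 : ContinuousAt S 0) (hb : S 0 = -b)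
    (hc : 0 < c) (hre : ∀ θ, |θ| ≤ Real.pi → (Q θ).re ≤ -c * θ ^ 2) :
    Tendsto (fun n : ℕ => (√n : ℂ) * ∫ θ in -Real.pi..Real.pi, k θ * Complex.exp (n * Q θ)) atTop
      (𝓝 (k 0 * √(Real.pi / b))) := by
  have hpi := Real.pi_pos
  obtain ⟨C, hC⟩ := (isCompact_Icc (a := -Real.pi) (b := Real.pi)).exists_bound_of_continuousOn
    hk.continuousOn
  set J : ℕ → Set ℝ := fun n => Set.Ioc (-Real.pi * √n) (Real.pi * √n)
  set f : ℕ → ℝ → ℂ := fun n => (J n).indicator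
    fun u => k (u / √n) * Complex.exp (n * Q (u / √n))
  have hlim : k 0 * (√(Real.pi / b) : ℂ) = ∫ u : ℝ, k 0 * Complex.exp (-b * u ^ 2) := by
    rw [integral_const_mul, ← integral_gaussian b, ← integral_complex_ofReal]
    push_cast
    rfl
  have hmem : ∀ {n : ℕ} {u : ℝ}, 0 < n → u ∈ J n → |u / √n| ≤ Real.pi := by
    intro n u hn hu
    have hs : 0 < √(n : ℝ) := Real.sqrt_pos.2 (by exact_mod_cast hn)
    rw [abs_le, le_div_iff₀ hs, div_le_iff₀ hs]
    exact ⟨hu.1.le, hu.2⟩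
  rw [hlim]
  have hmain : Tendsto (fun n => ∫ u, f n u) atTop
      (𝓝 (∫ u : ℝ, k 0 * Complex.exp (-b * u ^ 2))) := by
    refine tendsto_integral_filter_of_dominated_convergence (fun u => C * Real.exp (-c * u ^ 2))
      ?_ ?_ ((integrable_exp_neg_mul_sq hc).const_mul C) ?_
    · refine Eventually.of_forall fun n => ?_
      refine Measurable.aestronglyMeasurable (Measurable.indicator ?_ measurableSet_Ioc)
      exact Continuous.measurable (by fun_prop)
    · filter_upwards [eventually_gt_atTop 0] with n hn
      refine Eventually.of_forall fun u => ?_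
      have hs : 0 < (n : ℝ) := by exact_mod_cast hn
      have hC0 : 0 ≤ C := (norm_nonneg _).trans (hC 0 ⟨by linarith, hpi.le⟩)
      by_cases hu : u ∈ J n
      · have h := hmem hn hu
        simp only [f, Set.indicator_of_mem hu]
        rw [norm_mul, Complex.norm_exp]
        refine mul_le_mul (hC _ (abs_le.1 h)) (Real.exp_le_exp.2 ?_) (Real.exp_pos _).le hC0
        have h2 := mul_le_mul_of_nonneg_left (hre _ h) hs.le
        rw [div_pow, Real.sq_sqrt hs.le] at h2
        rw [← Complex.ofReal_natCast, Complex.re_ofReal_mul]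
        refine h2.trans_eq ?_
        field_simp
      · simp only [f, Set.indicator_of_notMem hu, norm_zero]
        positivity
    · refine Eventually.of_forall fun u => ?_
      have hsq : Tendsto (fun n : ℕ => √(n : ℝ)) atTop atTop :=
        Real.tendsto_sqrt_atTop.comp tendsto_natCast_atTop_atTop
      have h0 : Tendsto (fun n : ℕ => u / √(n : ℝ)) atTop (𝓝 0) := hsq.const_div_atTop u
      have hev : ∀ᶠ n : ℕ in atTop,
          k (u / √n) * Complex.exp (u ^ 2 * S (u / √n)) = f n u := by
        filter_upwards [eventually_gt_atTop 0, hsq.eventually_gt_atTop (|u| / Real.pi)] with n hn hu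
        have hs : (0 : ℝ) < n := by exact_mod_cast hn
        rw [div_lt_iff₀' hpi] at hu
        have hJ : u ∈ J n := ⟨by linarith [neg_abs_le u], by linarith [le_abs_self u]⟩
        simp only [f, Set.indicator_of_mem hJ, hS]
        congr 2
        have : (n : ℂ) * ((u / √n : ℝ) : ℂ) ^ 2 = (u : ℂ) ^ 2 := by
          norm_cast
          rw [div_pow, Real.sq_sqrt hs.le]
          field_simp
        rw [← this]
        ring
      refine Tendsto.congr' hev ?_
      refine ((hk.tendsto 0).comp h0).mul ?_
      have := (Complex.continuous_exp.tendsto _).comp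
        ((hS0.tendsto.comp h0).const_mul ((u : ℂ) ^ 2))
      rw [hb, mul_comm _ (-(b : ℂ))] at this
      exact this
  refine hmain.congr' ?_
  filter_upwards [eventually_gt_atTop 0] with n hn
  have hs : √(n : ℝ) ≠ 0 := (Real.sqrt_pos.2 (by exact_mod_cast hn)).ne'
  have h := intervalIntegral.integral_comp_div (a := -Real.pi * √n) (b := Real.pi * √n)
    (fun θ => k θ * Complex.exp (n * Q θ)) hs
  rw [mul_div_cancel_right₀ _ hs, mul_div_cancel_right₀ _ hs, Complex.real_smul] at h
  rw [← h, intervalIntegral.integral_of_le, ← integral_indicator measurableSet_Ioc]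
  nlinarith [Real.sqrt_nonneg (n : ℝ)]

/-- The function with `exp x = 1 + x + x ^ 2 * expRem x`, continuous at zero. -/
noncomputable def expRem (x : ℂ) : ℂ := if x = 0 then 1 / 2 else (Complex.exp x - 1 - x) / x ^ 2

lemma exp_eq_add_expRem (x : ℂ) : Complex.exp x = 1 + x + x ^ 2 * expRem x := by
  unfold expRem
  split_ifs with h
  · simp [h]
  · field_simp
    ring

lemma expRem_zero : expRem 0 = 1 / 2 := if_pos rfl

lemma continuousAt_expRem : ContinuousAt expRem 0 := by
  rw [ContinuousAt, expRem_zero, tendsto_iff_norm_sub_tendsto_zero]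
  refine squeeze_zero_norm' (a := fun x : ℂ => ‖x‖) ?_
    (by simpa using (continuous_norm (E := ℂ)).tendsto 0)
  have hsmall : ∀ᶠ x in 𝓝 (0 : ℂ), ‖x‖ ≤ 1 :=
    ((continuous_norm (E := ℂ)).tendsto 0).eventually_le_const (by simp)
  filter_upwards [hsmall] with x hx
  rw [norm_norm]
  unfold expRem
  split_ifs with h
  · simp
  have hb := Complex.exp_bound hx (n := 3) (by norm_num)
  have hx0 : 0 < ‖x‖ := norm_pos_iff.2 h
  have h2 : (Complex.exp x - 1 - x) / x ^ 2 - 1 / 2 =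
      (Complex.exp x - ∑ m ∈ Finset.range 3, x ^ m / (m.factorial : ℂ)) / x ^ 2 := by
    simp only [Finset.sum_range_succ, Finset.sum_range_zero, Nat.factorial]
    field_simp
    push_cast
    ring
  rw [h2, norm_div, norm_pow, div_le_iff₀ (by positivity)]
  refine hb.trans ?_
  have : (((3 : ℕ).succ : ℝ) * (((3 : ℕ).factorial : ℝ) * (3 : ℕ))⁻¹) ≤ 1 := by
    norm_num [Nat.factorial]
  nlinarith [pow_pos hx0 3]

lemma coef_eq_integral {r : ℝ} (hr : 0 < r) (n : ℕ) (F : ℂ → ℂ) :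
    (r : ℂ) ^ n * coef r n F = (2 * Real.pi : ℂ)⁻¹ * ∫ θ in -Real.pi..Real.pi,
      Complex.exp (-n * (θ * Complex.I)) * F (r * Complex.exp (θ * Complex.I)) := by
  have hr0 : (r : ℂ) ≠ 0 := by exact_mod_cast hr.ne'
  have hper : Function.Periodic (fun θ : ℝ => Complex.exp (-n * (θ * Complex.I)) *
      F (r * Complex.exp (θ * Complex.I))) (2 * Real.pi) := by
    intro θ
    have h : Complex.exp (((θ + 2 * Real.pi : ℝ) : ℂ) * Complex.I) =
        Complex.exp (θ * Complex.I) := by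
      push_cast
      rw [add_mul, Complex.exp_periodic]
    simp only [h, neg_mul]
    rw [Complex.exp_neg, Complex.exp_nat_mul, h, Complex.exp_neg, Complex.exp_nat_mul]
  have h := hper.intervalIntegral_add_eq (-Real.pi) 0
  rw [zero_add, show -Real.pi + 2 * Real.pi = Real.pi by ring] at h
  rw [h, coef, circleIntegral, mul_left_comm, ← intervalIntegral.integral_const_mul,
    ← intervalIntegral.integral_const_mul, ← intervalIntegral.integral_const_mul]
  refine intervalIntegral.integral_congr fun θ _ => ?_
  have he : Complex.exp (θ * Complex.I) ≠ 0 := Complex.exp_ne_zero _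
  have hpi : (Real.pi : ℂ) ≠ 0 := by exact_mod_cast Real.pi_ne_zero
  simp only [deriv_circleMap, circleMap, zero_add, smul_eq_mul, neg_mul]
  rw [Complex.exp_neg, Complex.exp_nat_mul, zpow_neg, zpow_add_one₀ (mul_ne_zero hr0 he),
    zpow_natCast, mul_pow]
  field_simp

/-- The exponent `ψ (r e ^ (iθ)) - ψ r - iθ` at the circle of radius `r`. -/
noncomputable def saddlePhase (r : ℝ) (θ : ℝ) : ℂ :=
  psi (r * Complex.exp (θ * Complex.I)) - psi r - θ * Complex.I

lemma pow_mul_coef_eq_integral {r : ℝ} (hr : 0 < r) (n : ℕ) (K : ℂ → ℂ) :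
    (r * Complex.exp (-psi r)) ^ n * coef r n (fun z => K z * Complex.exp (n * psi z)) =
      (2 * Real.pi : ℂ)⁻¹ * ∫ θ in -Real.pi..Real.pi,
        K (r * Complex.exp (θ * Complex.I)) * Complex.exp (n * saddlePhase r θ) := by
  rw [mul_pow, mul_right_comm, coef_eq_integral hr, mul_assoc, mul_comm (∫ _ in _.._, _),
    ← intervalIntegral.integral_const_mul]
  congr 1
  refine intervalIntegral.integral_congr fun θ _ => ?_
  simp only [saddlePhase]
  rw [← Complex.exp_nat_mul, show (n : ℂ) * (psi (r * Complex.exp (θ * Complex.I)) - psi r -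
    θ * Complex.I) = n * -psi r + (-n * (θ * Complex.I) +
      n * psi (r * Complex.exp (θ * Complex.I))) by ring, Complex.exp_add, Complex.exp_add]
  ring

lemma saddlePhase_eq (r θ : ℝ) :
    saddlePhase r θ = psi r * (Complex.exp (2 * θ * Complex.I +
      2 * r * (Complex.exp (θ * Complex.I) - 1)) - 1) - θ * Complex.I := by
  rw [saddlePhase, psi, psi, mul_pow, ← Complex.exp_nat_mul, mul_sub, mul_one,
    mul_assoc ((r : ℂ) ^ 2), mul_assoc ((r : ℂ) ^ 2), ← Complex.exp_add, ← Complex.exp_add]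
  push_cast
  ring_nf

/-- The quotient of `saddlePhase r θ` by `θ ^ 2` at a saddle point `r`. -/
noncomputable def saddleQuotient (r : ℝ) (θ : ℝ) : ℂ :=
  psi r * (-2 * r * expRem (θ * Complex.I) +
    (2 * (1 + r) * Complex.I - 2 * r * θ * expRem (θ * Complex.I)) ^ 2 *
      expRem (θ * (2 * (1 + r) * Complex.I - 2 * r * θ * expRem (θ * Complex.I))))

lemma saddlePhase_eq_sq_mul {r : ℝ} (hr : 2 * (1 + r) * psi r = 1) (θ : ℝ) :
    saddlePhase r θ = θ ^ 2 * saddleQuotient r θ := by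
  have h1 := exp_eq_add_expRem (θ * Complex.I)
  have hI : Complex.I ^ 2 = -1 := Complex.I_sq
  have h2 : 2 * θ * Complex.I + 2 * r * (Complex.exp (θ * Complex.I) - 1) =
      θ * (2 * (1 + r) * Complex.I - 2 * r * θ * expRem (θ * Complex.I)) := by
    rw [h1]
    linear_combination 2 * (r : ℂ) * θ ^ 2 * expRem (θ * Complex.I) * hI
  rw [saddlePhase_eq, h2, exp_eq_add_expRem (θ * (_ - _)), saddleQuotient]
  linear_combination (θ : ℂ) * Complex.I * hr

lemma continuousAt_saddleQuotient (r : ℝ) : ContinuousAt (saddleQuotient r) 0 := by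
  have h1 : ContinuousAt (fun θ : ℝ => expRem (θ * Complex.I)) 0 :=
    ContinuousAt.comp (g := expRem) (f := fun θ : ℝ => (θ : ℂ) * Complex.I)
      (by simpa using continuousAt_expRem) (by fun_prop)
  have h2 : ContinuousAt (fun θ : ℝ =>
      (θ : ℂ) * (2 * (1 + r) * Complex.I - 2 * r * θ * expRem (θ * Complex.I))) 0 := by
    fun_prop
  have h3 : ContinuousAt (fun θ : ℝ =>
      expRem (θ * (2 * (1 + r) * Complex.I - 2 * r * θ * expRem (θ * Complex.I)))) 0 :=
    ContinuousAt.comp (g := expRem) (by simpa using continuousAt_expRem) h2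
  unfold saddleQuotient
  fun_prop

lemma saddleQuotient_zero (r : ℝ) :
    saddleQuotient r 0 = -(psi r * (r + 2 * (1 + r) ^ 2)) := by
  simp only [saddleQuotient, Complex.ofReal_zero, zero_mul, mul_zero, expRem_zero, sub_zero]
  linear_combination psi r * 2 * (1 + r) ^ 2 * Complex.I_sq

lemma psi_ofReal (r : ℝ) : psi r = ((r ^ 2 * Real.exp (2 * r) : ℝ) : ℂ) := by
  rw [psi]
  push_cast
  rfl

lemma saddlePhase_re_le {r : ℝ} (hr : 0 < r) {θ : ℝ} (hθ : |θ| ≤ Real.pi) :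
    (saddlePhase r θ).re ≤
      -(r ^ 2 * Real.exp (2 * r) * (2 * r * (2 / Real.pi ^ 2)) / (1 + 4 * r)) * θ ^ 2 := by
  set p := r ^ 2 * Real.exp (2 * r) with hp
  have hp0 : 0 < p := by positivity
  set y := 2 * r * (1 - Real.cos θ) with hy
  have hy0 : 0 ≤ y := mul_nonneg (by positivity) (sub_nonneg.2 (Real.cos_le_one θ))
  have hyr : y ≤ 4 * r := by nlinarith [Real.neg_one_le_cos θ]
  have hyθ : 2 * r * (2 / Real.pi ^ 2) * θ ^ 2 ≤ y := by
    have := Real.cos_le_one_sub_mul_cos_sq hθ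
    rw [hy, mul_assoc]
    gcongr
    linarith
  have hre : (saddlePhase r θ).re ≤ p * (Real.exp (-y) - 1) := by
    rw [saddlePhase_eq, psi_ofReal, ← hp, Complex.sub_re, Complex.re_ofReal_mul, Complex.sub_re]
    have h1 : ((θ : ℂ) * Complex.I).re = 0 := by simp
    have h2 : (2 * θ * Complex.I + 2 * r * (Complex.exp (θ * Complex.I) - 1) : ℂ).re = -y := by
      have : (2 * θ * Complex.I + 2 * r * (Complex.exp (θ * Complex.I) - 1) : ℂ) =
          ((2 * θ : ℝ) : ℂ) * Complex.I + (2 * r : ℝ) * (Complex.exp (θ * Complex.I) - 1) := by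
        push_cast
        ring
      rw [this, Complex.add_re, Complex.re_ofReal_mul, Complex.re_ofReal_mul, Complex.sub_re,
        Complex.exp_ofReal_mul_I_re, Complex.I_re, Complex.one_re, hy]
      ring
    rw [h1, sub_zero, Complex.one_re]
    gcongr
    rw [← h2, ← Complex.norm_exp]
    exact Complex.re_le_norm _
  have hexp : Real.exp (-y) - 1 ≤ -(y / (1 + 4 * r)) := by
    have h1 : (1 + y) * Real.exp (-y) ≤ 1 := by
      have := Real.add_one_le_exp y
      calc (1 + y) * Real.exp (-y) ≤ Real.exp y * Real.exp (-y) := by gcongr; linarith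
        _ = 1 := by rw [← Real.exp_add, add_neg_cancel, Real.exp_zero]
    have h2 : Real.exp (-y) ≤ 1 / (1 + y) := by
      rw [le_div_iff₀ (by positivity)]
      linarith
    have h3 : y / (1 + 4 * r) ≤ y / (1 + y) := by gcongr
    have h4 : 1 / (1 + y) = 1 - y / (1 + y) := by field_simp; ring
    linarith
  calc _ ≤ p * (Real.exp (-y) - 1) := hre
    _ ≤ p * -(y / (1 + 4 * r)) := by gcongr
    _ ≤ p * -(2 * r * (2 / Real.pi ^ 2) * θ ^ 2 / (1 + 4 * r)) := by gcongr
    _ = _ := by ring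

lemma exists_saddlePoint :
    ∃ r : ℝ, 0 < r ∧ r < 21 / 50 ∧ 2 * (1 + r) * (r ^ 2 * Real.exp (2 * r)) = 1 := by
  have hc : ContinuousOn (fun r : ℝ => 2 * (1 + r) * (r ^ 2 * Real.exp (2 * r)))
      (Set.Icc 0 (21 / 50)) := by fun_prop
  have hend : 1 < 2 * (1 + 21 / 50) * ((21 / 50) ^ 2 * Real.exp (2 * (21 / 50))) := by
    have h1 := Real.add_one_le_exp (21 / 50 : ℝ)
    have h2 : Real.exp (2 * (21 / 50)) = Real.exp (21 / 50) ^ 2 := by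
      rw [← Real.exp_nat_mul]
      norm_num
    rw [h2]
    nlinarith
  obtain ⟨r, hr, hr1⟩ := intermediate_value_Ioo (by norm_num) hc
    (show (1 : ℝ) ∈ Set.Ioo _ _ from ⟨by norm_num, hend⟩)
  exact ⟨r, hr.1, hr.2, hr1⟩

lemma mul_exp_neg_lt_exp_neg_one {r p : ℝ} (hr : 0 < r) (hr1 : r < 21 / 50)
    (hp : 2 * (1 + r) * p = 1) : r * Real.exp (-p) < Real.exp (-1) := by
  have hp1 : 7 / 20 ≤ p := by nlinarith
  have h1 := Real.add_one_le_exp (-13 / 40 : ℝ)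
  have h2 : Real.exp (-1) = Real.exp (-13 / 40) ^ 2 * Real.exp (-7 / 20) := by
    rw [← Real.exp_nat_mul, ← Real.exp_add]
    norm_num
  rw [h2]
  have h3 : Real.exp (-p) ≤ Real.exp (-7 / 20) := Real.exp_le_exp.2 (by linarith)
  have h4 : r < Real.exp (-13 / 40) ^ 2 := by nlinarith
  exact mul_lt_mul h4 h3 (Real.exp_pos _) (by positivity)

lemma saddleAmplitude_ofReal {r : ℝ} (hr : 2 * (1 + r) * (r ^ 2 * Real.exp (2 * r)) = 1) :
    saddleAmplitude r = ((r * (1 + (2 * r + 2 * r ^ 2) * Real.exp (2 * r)) *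
      Real.exp (r - (r ^ 2 * Real.exp (2 * r)) ^ 2 / 2 +
        (1 / 2 - r) * (r ^ 2 * Real.exp (2 * r))) : ℝ) : ℂ) := by
  have hj : jac r = 0 := by
    have h : (2 * (1 + r) * (r ^ 2 * Complex.exp (2 * r)) : ℂ) = 1 := by exact_mod_cast hr
    rw [jac, psiDeriv]
    linear_combination -h
  rw [saddleAmplitude, hj, forestGF, treeGF, psiDeriv, psi]
  push_cast
  ring

end SaddlePoint

lemma continuous_saddlePhase (r : ℝ) : Continuous (saddlePhase r) := by
  unfold saddlePhase
  have := differentiable_psi.continuous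
  fun_prop

lemma mN_mul_pow_mul_rpow_div_factorial {r : ℝ} (hr : 0 < r) {n : ℕ} (hn : 0 < n) :
    (((mN n : ℝ) * (r * Real.exp (-(r ^ 2 * Real.exp (2 * r)))) ^ n * (n : ℝ) ^ ((5 : ℝ) / 2) /
      (Nat.factorial n : ℝ) : ℝ) : ℂ) =
      (2 * Real.pi : ℂ)⁻¹ * ((√n : ℂ) * ∫ θ in -Real.pi..Real.pi,
        saddleAmplitude (r * Complex.exp (θ * Complex.I)) *
          Complex.exp (n * saddlePhase r θ)) := by
  have hpow : (n : ℝ) ^ ((5 : ℝ) / 2) = (n : ℝ) ^ 2 * √n := by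
    have h0 : (0 : ℝ) < n := by exact_mod_cast hn
    rw [Real.sqrt_eq_rpow, ← Real.rpow_natCast, ← Real.rpow_add h0]
    norm_num
  have hfac : (n.factorial : ℂ) ≠ 0 := by exact_mod_cast n.factorial_ne_zero
  have hρ : ((r * Real.exp (-(r ^ 2 * Real.exp (2 * r))) : ℝ) : ℂ) =
      r * Complex.exp (-psi r) := by
    rw [psi_ofReal]
    push_cast
    ring
  have key : ((mN n : ℂ) * (r * Complex.exp (-psi r)) ^ n * ((n : ℂ) ^ 2 * (√n : ℝ)) /
      n.factorial) = (√n : ℝ) * ((r * Complex.exp (-psi r)) ^ n *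
        coef r n (fun z => saddleAmplitude z * Complex.exp (n * psi z))) := by
    rw [div_eq_iff hfac]
    linear_combination ((r * Complex.exp (-psi r)) ^ n * (√n : ℝ)) * sq_mul_mN_eq hr n
  rw [pow_mul_coef_eq_integral hr] at key
  rw [hpow, Complex.ofReal_div, Complex.ofReal_mul, Complex.ofReal_mul, Complex.ofReal_pow, hρ,
    Complex.ofReal_mul, Complex.ofReal_pow, Complex.ofReal_natCast, Complex.ofReal_natCast,
    Complex.ofReal_natCast, key]
  ring

theorem stmt_5 :
    ∃ A₂ ρ₂ : ℝ, 0 < A₂ ∧ 0 < ρ₂ ∧ ρ₂ < Real.exp (-1) ∧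
      Tendsto
        (fun n : ℕ =>
          (mN n : ℝ) * ρ₂ ^ n * (n : ℝ) ^ ((5 : ℝ) / 2) / (Nat.factorial n : ℝ))
        atTop (nhds A₂) := by
  obtain ⟨r, hr, hr1, hsp⟩ := exists_saddlePoint
  have hspC : 2 * (1 + (r : ℂ)) * psi r = 1 := by
    rw [psi_ofReal]
    exact_mod_cast hsp
  have hb : 0 < r ^ 2 * Real.exp (2 * r) * (r + 2 * (1 + r) ^ 2) := by positivity
  have hlim := (tendsto_sqrt_mul_integral_exp
    (k := fun θ : ℝ => saddleAmplitude (r * Complex.exp (θ * Complex.I)))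
    (b := r ^ 2 * Real.exp (2 * r) * (r + 2 * (1 + r) ^ 2))
    (by have := differentiable_saddleAmplitude.continuous; fun_prop)
    (continuous_saddlePhase r) (saddlePhase_eq_sq_mul hspC) (continuousAt_saddleQuotient r)
    (by rw [saddleQuotient_zero, psi_ofReal]; push_cast; ring)
    (by positivity : 0 < r ^ 2 * Real.exp (2 * r) * (2 * r * (2 / Real.pi ^ 2)) / (1 + 4 * r))
    (fun θ hθ => saddlePhase_re_le hr hθ)).const_mul ((2 * Real.pi : ℂ)⁻¹)
  rw [Complex.ofReal_zero, zero_mul, Complex.exp_zero, mul_one, saddleAmplitude_ofReal hsp] at hlim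
  refine ⟨(2 * Real.pi)⁻¹ * ((r * (1 + (2 * r + 2 * r ^ 2) * Real.exp (2 * r)) *
    Real.exp (r - (r ^ 2 * Real.exp (2 * r)) ^ 2 / 2 +
      (1 / 2 - r) * (r ^ 2 * Real.exp (2 * r)))) *
    √(Real.pi / (r ^ 2 * Real.exp (2 * r) * (r + 2 * (1 + r) ^ 2)))),
    r * Real.exp (-(r ^ 2 * Real.exp (2 * r))), by positivity, by positivity,
    mul_exp_neg_lt_exp_neg_one hr hr1 hsp, ?_⟩
  rw [← Filter.tendsto_ofReal_iff]
  refine Tendsto.congr' (f₁ := _) ?_ (hlim.trans_eq ?_)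
  · filter_upwards [eventually_gt_atTop 0] with n hn
    exact (mN_mul_pow_mul_rpow_div_factorial hr hn).symm
  · push_cast
    rfl
end
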